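/- arXiv:1003.1659 — 5 statements merged into one kernel-verified Lean document; each statement's English description precedes it below -/
import Mathlib

section
/- Let p be a prime number with p ≥ 47 (so that the residue field of ℚ_p has at least 47 elements). Then for every natural number n with n ≥ 25, every homogeneous polynomial of degree 5 in n+1 variables with coefficients in ℚ_p has a nontrivial zero: there exists x ∈ ℚ_p^{n+1} with x ≠ 0 and f(x) = 0. -/
section SquareValues

open Polynomial

variable {p : ℕ} [Fact p.Prime]

/-- The numerators `T i` in the formula `dⁱ/dXⁱ √A = √A · T i / Aⁱ`. -/
noncomputable def sqrtDerivNum {F : Type*} [Field F] (A : F[X]) : ℕ → F[X]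
  | 0 => 1
  | i + 1 => A * derivative (sqrtDerivNum A i) +
      C (1 / 2 - (i : F)) * derivative A * sqrtDerivNum A i

theorem natDegree_sqrtDerivNum_le {F : Type*} [Field F] (A : F[X]) {d : ℕ}
    (hA : A.natDegree ≤ d + 1) (i : ℕ) : (sqrtDerivNum A i).natDegree ≤ i * d := by
  induction i with
  | zero => simp [sqrtDerivNum]
  | succ i ih =>
    have hA' : (derivative A).natDegree ≤ d := (natDegree_derivative_le A).trans (by omega)
    rw [sqrtDerivNum, add_mul, one_mul]
    refine natDegree_add_le_of_degree_le ?_ ?_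
    · by_cases h0 : (sqrtDerivNum A i).natDegree = 0
      · rw [natDegree_eq_zero] at h0
        obtain ⟨c, hc⟩ := h0
        simp [← hc]
      · refine natDegree_mul_le.trans ?_
        have := natDegree_derivative_le (sqrtDerivNum A i)
        omega
    · refine natDegree_mul_le.trans ?_
      have := natDegree_C_mul_le (1 / 2 - (i : F)) (derivative A)
      omega

theorem dvd_sqrtDerivNum_sub {F : Type*} [Field F] (A : F[X]) (i : ℕ) :
    A ∣ sqrtDerivNum A i -
      C (∏ j ∈ Finset.range i, (1 / 2 - (j : F))) * derivative A ^ i := by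
  induction i with
  | zero => simp [sqrtDerivNum]
  | succ i ih =>
    obtain ⟨B, hB⟩ := ih
    refine ⟨derivative (sqrtDerivNum A i) + C (1 / 2 - (i : F)) * derivative A * B, ?_⟩
    rw [sqrtDerivNum, Finset.prod_range_succ, C_mul]
    linear_combination C (1 / 2 - (i : F)) * derivative A * hB

theorem sqrtDerivNum_five_ne_zero (hp : 7 < p) {A : (ZMod p)[X]} (hA : Squarefree A)
    (hdeg : A.natDegree ≠ 0) : sqrtDerivNum A 5 ≠ 0 := by
  intro h
  have hd := dvd_sqrtDerivNum_sub A 5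
  rw [h, zero_sub, dvd_neg] at hd
  have hcop : IsCoprime A (derivative A) := PerfectField.separable_iff_squarefree.mpr hA
  have hd' := (hcop.pow_right (n := 5)).dvd_of_dvd_mul_right hd
  have hk : ∀ k : ℕ, 0 < k → k < p → (k : ZMod p) ≠ 0 := fun k h0 hk h =>
    absurd (Nat.le_of_dvd h0 ((ZMod.natCast_eq_zero_iff k p).mp h)) (by omega)
  have h2 : (2 : ZMod p) ≠ 0 := by exact_mod_cast hk 2 (by omega) (by omega)
  have h3 : (3 : ZMod p) ≠ 0 := by exact_mod_cast hk 3 (by omega) (by omega)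
  have h5 : (5 : ZMod p) ≠ 0 := by exact_mod_cast hk 5 (by omega) (by omega)
  have h7 : (7 : ZMod p) ≠ 0 := by exact_mod_cast hk 7 (by omega) (by omega)
  have hc : (∏ j ∈ Finset.range 5, (1 / 2 - (j : ZMod p))) = 3 * 5 * 7 / 2 ^ 5 := by
    simp only [Finset.prod_range_succ, Finset.prod_range_zero]
    field_simp
    norm_num
  rw [hc] at hd'
  have hu : IsUnit (C (3 * 5 * 7 / 2 ^ 5 : ZMod p)) := by
    rw [isUnit_C, isUnit_iff_ne_zero]
    positivity
  exact hdeg (natDegree_eq_zero_of_isUnit (isUnit_of_dvd_unit hd' hu))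

/-- The auxiliary polynomial: `24 A⁴ / √A` times the difference between `-√A ^ p` and the Taylor
polynomial of order four of `√A` at `X`, evaluated at `X ^ p`. -/
noncomputable def taylorGap (A : (ZMod p)[X]) : (ZMod p)[X] :=
  24 * A ^ ((p - 1) / 2 + 4) + 24 * A ^ 4 + 24 * (X ^ p - X) * sqrtDerivNum A 1 * A ^ 3 +
    12 * (X ^ p - X) ^ 2 * sqrtDerivNum A 2 * A ^ 2 + 4 * (X ^ p - X) ^ 3 * sqrtDerivNum A 3 * A +
    (X ^ p - X) ^ 4 * sqrtDerivNum A 4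

theorem taylorGap_derivative (hp : 7 < p) (A : (ZMod p)[X]) :
    2 * A * derivative (taylorGap A) =
      7 * derivative A * taylorGap A + 2 * (X ^ p - X) ^ 4 * sqrtDerivNum A 5 := by
  have hodd : 2 * ((p - 1) / 2) + 1 = p := by
    have := (Fact.out : p.Prime).eq_two_or_odd
    omega
  have hM : (2 * ((((p - 1) / 2 : ℕ)) : (ZMod p)[X]) + 1) = 0 := by
    have : (((2 * ((p - 1) / 2) + 1 : ℕ)) : (ZMod p)[X]) = 0 := by
      rw [hodd]; exact CharP.cast_eq_zero _ p
    exact_mod_cast this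
  have h2 : (2 : ZMod p) ≠ 0 := by
    intro h
    have h' : ((2 : ℕ) : ZMod p) = 0 := by exact_mod_cast h
    have := Nat.le_of_dvd (by omega) ((ZMod.natCast_eq_zero_iff 2 p).mp h')
    omega
  have hh : (2 : (ZMod p)[X]) * C (1 / 2) = 1 := by
    rw [← map_ofNat C 2, ← C_mul, mul_one_div_cancel h2, C_1]
  have hX : derivative (X ^ p - X : (ZMod p)[X]) = -1 := by
    simp [derivative_X_pow, CharP.cast_eq_zero]
  have e1 : sqrtDerivNum A 1 = C (1 / 2) * derivative A := by simp [sqrtDerivNum]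
  have e (i : ℕ) : A * derivative (sqrtDerivNum A i) = sqrtDerivNum A (i + 1)
      - (C (1 / 2) - (i : (ZMod p)[X])) * derivative A * sqrtDerivNum A i := by
    rw [sqrtDerivNum]; simp only [C_sub, map_natCast]; ring
  have E1 := e 1
  have E2 := e 2
  have E3 := e 3
  have E4 := e 4
  simp only [Nat.cast_ofNat, Nat.cast_one, Nat.reduceAdd] at E1 E2 E3 E4
  unfold taylorGap
  generalize sqrtDerivNum A 5 = T5 at *
  generalize sqrtDerivNum A 4 = T4 at *
  generalize sqrtDerivNum A 3 = T3 at *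
  generalize sqrtDerivNum A 2 = T2 at *
  generalize sqrtDerivNum A 1 = T1 at *
  generalize hs : (X ^ p - X : (ZMod p)[X]) = s at *
  generalize hm : (p - 1) / 2 = M at *
  have ht : ∀ (k : ℕ), derivative ((k : (ZMod p)[X])) = 0 := fun k => derivative_natCast
  have d24 : derivative (24 : (ZMod p)[X]) = 0 := ht 24
  have d12 : derivative (12 : (ZMod p)[X]) = 0 := ht 12
  have d4 : derivative (4 : (ZMod p)[X]) = 0 := ht 4
  simp only [derivative_add, derivative_mul, derivative_pow, hX, d24, d12, d4]
  simp only [Nat.cast_add, Nat.cast_ofNat, map_add, map_natCast, map_ofNat]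
  generalize C (1 / 2 : ZMod p) = h at *
  generalize derivative A = A' at *
  rw [show M + 4 - 1 = M + 3 by omega]
  norm_num
  linear_combination 24 * A ^ (M + 4) * A' * hM - 48 * A ^ 4 * e1 +
    48 * s * A ^ 3 * E1 + 24 * s ^ 2 * A ^ 2 * E2 + 8 * s ^ 3 * A * E3 + 2 * s ^ 4 * E4 -
    (24 * A ^ 4 * A' + 24 * s * A ^ 3 * A' * T1 + 12 * s ^ 2 * A ^ 2 * A' * T2 +
      4 * s ^ 3 * A * A' * T3 + s ^ 4 * A' * T4) * hh

theorem natDegree_taylorGap_le {A : (ZMod p)[X]} {d : ℕ} (hA : A.natDegree ≤ d + 1)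
    (hd : d ≤ 7) : (taylorGap A).natDegree ≤ 4 * p + 4 * d := by
  have hp1 : 1 ≤ p := (Fact.out : p.Prime).one_le
  have hs : (X ^ p - X : (ZMod p)[X]).natDegree ≤ p :=
    (natDegree_sub_le_of_le (natDegree_X_pow_le p) (natDegree_X_le.trans hp1)).trans
      (max_self p).le
  have hT := natDegree_sqrtDerivNum_le A hA
  have hpow (k : ℕ) : (A ^ k).natDegree ≤ k * (d + 1) := natDegree_pow_le_of_le k hA
  have hspow (k : ℕ) : ((X ^ p - X : (ZMod p)[X]) ^ k).natDegree ≤ k * p :=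
    natDegree_pow_le_of_le k hs
  have hnum (k : ℕ) : ((k : (ZMod p)[X])).natDegree ≤ 0 := (natDegree_natCast k).le
  have hnum24 : ((24 : (ZMod p)[X])).natDegree ≤ 0 := hnum 24
  have hnum12 : ((12 : (ZMod p)[X])).natDegree ≤ 0 := hnum 12
  have hnum4 : ((4 : (ZMod p)[X])).natDegree ≤ 0 := hnum 4
  unfold taylorGap
  refine natDegree_add_le_of_degree_le (natDegree_add_le_of_degree_le
    (natDegree_add_le_of_degree_le (natDegree_add_le_of_degree_le
    (natDegree_add_le_of_degree_le ?_ ?_) ?_) ?_) ?_) ?_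
  · refine (natDegree_mul_le_of_le hnum24 (hpow _)).trans ?_
    have h1 : 2 * ((p - 1) / 2) ≤ p - 1 := Nat.mul_div_le _ _
    have h2 : (p - 1) / 2 * (d + 1) ≤ (p - 1) / 2 * 8 := Nat.mul_le_mul_left _ (by omega)
    rw [add_mul]
    omega
  · exact (natDegree_mul_le_of_le hnum24 (hpow _)).trans (by omega)
  · exact (natDegree_mul_le_of_le (natDegree_mul_le_of_le (natDegree_mul_le_of_le hnum24 hs)
      (hT 1)) (hpow 3)).trans (by omega)
  · exact (natDegree_mul_le_of_le (natDegree_mul_le_of_le (natDegree_mul_le_of_le hnum12 (hspow 2))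
      (hT 2)) (hpow 2)).trans (by omega)
  · exact (natDegree_mul_le_of_le (natDegree_mul_le_of_le (natDegree_mul_le_of_le hnum4 (hspow 3))
      (hT 3)) hA).trans (by omega)
  · exact (natDegree_mul_le_of_le (hspow 4) (hT 4)).trans (by omega)

theorem X_sub_C_dvd_X_pow_sub_X (x : ZMod p) : X - C x ∣ (X ^ p - X : (ZMod p)[X]) := by
  rw [dvd_iff_isRoot]
  simp [ZMod.pow_card]

theorem pow_four_dvd_taylorGap {A : (ZMod p)[X]} {x : ZMod p} (hx : A.eval x = 0) :
    (X - C x) ^ 4 ∣ taylorGap A := by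
  obtain ⟨B, hB⟩ := dvd_iff_isRoot.mpr hx
  obtain ⟨S, hS⟩ := X_sub_C_dvd_X_pow_sub_X x
  unfold taylorGap
  rw [hS]
  generalize sqrtDerivNum A 4 = T4
  generalize sqrtDerivNum A 3 = T3
  generalize sqrtDerivNum A 2 = T2
  generalize sqrtDerivNum A 1 = T1
  rw [hB]
  generalize X - C x = Y
  refine ⟨24 * Y ^ ((p - 1) / 2) * B ^ ((p - 1) / 2 + 4) + 24 * B ^ 4 +
    24 * S * T1 * B ^ 3 + 12 * S ^ 2 * T2 * B ^ 2 + 4 * S ^ 3 * T3 * B + S ^ 4 * T4, ?_⟩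
  simp only [mul_pow, pow_add]
  ring

theorem pow_five_dvd_taylorGap (hp : 7 < p) {A : (ZMod p)[X]} {x : ZMod p}
    (hx : A.eval x ^ ((p - 1) / 2) = -1) : (X - C x) ^ 5 ∣ taylorGap A := by
  have hA : A.eval x ≠ 0 := by
    intro h
    rw [h, zero_pow (by omega)] at hx
    exact one_ne_zero (neg_eq_zero.mp hx.symm)
  have hk : ∀ k : ℕ, 0 < k → k < p → (k : ZMod p) ≠ 0 := fun k h0 hk h =>
    absurd (Nat.le_of_dvd h0 ((ZMod.natCast_eq_zero_iff k p).mp h)) (by omega)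
  have h2 : (2 : ZMod p) ≠ 0 := by exact_mod_cast hk 2 (by omega) (by omega)
  obtain ⟨S, hS⟩ := X_sub_C_dvd_X_pow_sub_X x
  have step (k : ℕ) (hk0 : 0 < k) (hk4 : k ≤ 4) (h : (X - C x) ^ k ∣ taylorGap A) :
      (X - C x) ^ (k + 1) ∣ taylorGap A := by
    obtain ⟨Q, hQ⟩ := h
    have hder := taylorGap_derivative hp A
    rw [hS, hQ] at hder
    obtain ⟨m, rfl⟩ : ∃ m, k = m + 1 := ⟨k - 1, by omega⟩
    obtain ⟨j, hj⟩ : ∃ j, 4 = m + 1 + j := ⟨4 - (m + 1), by omega⟩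
    have hne : (X - C x) ^ m ≠ 0 := pow_ne_zero _ (X_sub_C_ne_zero x)
    have hQx : (2 * ((m + 1 : ℕ) : ZMod p) * A.eval x) * Q.eval x = 0 := by
      have hcancel : 2 * A * (((m + 1 : ℕ) : (ZMod p)[X]) * Q + (X - C x) * derivative Q) =
          (X - C x) * (7 * derivative A * Q + 2 * (X - C x) ^ j * S ^ 4 * sqrtDerivNum A 5) := by
        apply mul_left_cancel₀ hne
        simp only [derivative_mul, derivative_pow, derivative_sub, derivative_X, derivative_C,
          map_natCast, Nat.add_sub_cancel] at hder
        have e4 : ((X - C x) * S) ^ 4 = (X - C x) ^ (m + 1) * (X - C x) ^ j * S ^ 4 := by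
          rw [mul_pow, ← pow_add, ← hj]
        rw [e4] at hder
        linear_combination hder
      have := congrArg (Polynomial.eval x) hcancel
      simp only [eval_mul, eval_add, eval_sub, eval_X, eval_C, eval_natCast, eval_ofNat,
        sub_self, zero_mul, add_zero] at this
      linear_combination this
    have hQ0 : Q.eval x = 0 := by
      refine (mul_eq_zero.mp hQx).resolve_left ?_
      exact mul_ne_zero (mul_ne_zero h2 (hk _ (by omega) (by omega))) hA
    obtain ⟨R, hR⟩ := dvd_iff_isRoot.mpr hQ0
    exact ⟨R, by rw [hQ, hR]; ring⟩
  have h1 : (X - C x) ^ 1 ∣ taylorGap A := by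
    rw [pow_one, dvd_iff_isRoot, IsRoot]
    unfold taylorGap
    simp only [eval_add, eval_mul, eval_pow, eval_sub, eval_X, eval_ofNat, ZMod.pow_card, sub_self]
    rw [pow_add, hx]
    ring
  exact step 4 (by omega) le_rfl (step 3 (by omega) (by omega)
    (step 2 (by omega) (by omega) (step 1 (by omega) (by omega) h1)))

theorem sum_le_natDegree_of_pow_dvd {F : Type*} [Field F] [Fintype F] {P : F[X]} (hP : P ≠ 0)
    (e : F → ℕ) (h : ∀ x, (X - C x) ^ e x ∣ P) : ∑ x, e x ≤ P.natDegree := by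
  have hd : ∏ x, (X - C x) ^ e x ∣ P := Finset.prod_dvd_of_coprime
    (fun x _ y _ hxy => (isCoprime_X_sub_C_of_isUnit_sub
      (sub_ne_zero.mpr hxy).isUnit).pow) (fun x _ => h x)
  have := natDegree_le_of_dvd hd hP
  rw [natDegree_prod_of_monic _ _ (fun x _ => (monic_X_sub_C x).pow _)] at this
  simpa using this

theorem exists_eq_squarefree_mul_sq {F : Type*} [Field F] {D : F[X]} (hD : D ≠ 0) :
    ∃ A B : F[X], Squarefree A ∧ D = A * B ^ 2 := by
  induction hn : D.natDegree using Nat.strong_induction_on generalizing D with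
  | _ n ih =>
    by_cases hs : Squarefree D
    · exact ⟨D, 1, hs, by simp⟩
    · simp only [Squarefree, not_forall] at hs
      obtain ⟨Y, ⟨E, hE⟩, hY⟩ := hs
      have hE0 : E ≠ 0 := by rintro rfl; simp_all
      have hY0 : Y ≠ 0 := by rintro rfl; simp_all
      have hYdeg : Y.natDegree ≠ 0 := fun h => hY (by
        obtain ⟨c, rfl⟩ := natDegree_eq_zero.mp h
        exact isUnit_C.mpr (isUnit_iff_ne_zero.mpr (by rintro rfl; simp at hY0)))
      have hdeg : D.natDegree = Y.natDegree + Y.natDegree + E.natDegree := by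
        rw [hE, natDegree_mul (mul_ne_zero hY0 hY0) hE0, natDegree_mul hY0 hY0]
      obtain ⟨A, B, hA, hAB⟩ := ih E.natDegree (by omega) hE0 rfl
      exact ⟨A, Y * B, hA, by rw [hE, hAB]; ring⟩

/-- A polynomial of degree at most `8` over `𝔽_p` that takes no nonzero square value is a
nonsquare constant times a square. -/
theorem exists_eq_nonsquare_mul_sq (hp : 37 ≤ p) {D : (ZMod p)[X]} (hD : D.natDegree ≤ 8)
    (h : ∀ x y, D.eval x = y ^ 2 → y = 0) :
    ∃ (ε : ZMod p) (E : (ZMod p)[X]), ¬ IsSquare ε ∧ D = C ε * E ^ 2 := by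
  classical
  by_cases hD0 : D = 0
  · obtain ⟨ε, hε⟩ := FiniteField.exists_nonsquare (F := ZMod p) (by
      rw [ZMod.ringChar_zmod_n]; omega)
    exact ⟨ε, 0, hε, by simp [hD0]⟩
  obtain ⟨A, B, hA, rfl⟩ := exists_eq_squarefree_mul_sq hD0
  have hA0 : A ≠ 0 := fun h => hD0 (by simp [h])
  have hB0 : B ≠ 0 := fun h => hD0 (by simp [h])
  have hdeg : A.natDegree + 2 * B.natDegree ≤ 8 := by
    rwa [natDegree_mul hA0 (pow_ne_zero 2 hB0), natDegree_pow] at hD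
  have hnsq (x : ZMod p) (hBx : B.eval x ≠ 0) (hAx : A.eval x ≠ 0) : ¬ IsSquare (A.eval x) := by
    rintro ⟨y, hy⟩
    have := h x (y * B.eval x) (by rw [eval_mul, eval_pow, hy]; ring)
    rcases mul_eq_zero.mp this with h' | h'
    · exact hAx (by rw [hy, h', zero_mul])
    · exact hBx h'
  have hcard (P : (ZMod p)[X]) (hP : P ≠ 0) :
      (Finset.univ.filter fun x => P.eval x = 0).card ≤ P.natDegree := by
    refine (Finset.card_le_card ?_).trans ((Multiset.toFinset_card_le _).trans (card_roots' P))
    intro x hx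
    simpa [hP] using hx
  by_cases hconst : A.natDegree = 0
  · obtain ⟨ε, rfl⟩ := natDegree_eq_zero.mp hconst
    refine ⟨ε, B, ?_, rfl⟩
    obtain ⟨x, hx⟩ : ∃ x, B.eval x ≠ 0 := by
      by_contra! hall
      have := hcard B hB0
      simp only [hall, Finset.filter_true, Finset.card_univ, ZMod.card] at this
      omega
    simpa using hnsq x hx (by simpa using hA0)
  · exfalso
    have hgap : taylorGap A ≠ 0 := by
      intro h0
      have hder := taylorGap_derivative (by omega) A
      rw [h0, derivative_zero, mul_zero, mul_zero, zero_add] at hder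
      have h2 : (2 : (ZMod p)[X]) ≠ 0 := by
        rw [← map_ofNat C 2, Ne, C_eq_zero]
        intro h
        have h' : ((2 : ℕ) : ZMod p) = 0 := by exact_mod_cast h
        have := Nat.le_of_dvd (by omega) ((ZMod.natCast_eq_zero_iff 2 p).mp h')
        omega
      have hs : (X ^ p - X : (ZMod p)[X]) ≠ 0 :=
        FiniteField.X_pow_card_sub_X_ne_zero _ (by omega)
      exact mul_ne_zero (mul_ne_zero h2 (pow_ne_zero 4 hs))
        (sqrtDerivNum_five_ne_zero (by omega) hA hconst) hder.symm
    let e : ZMod p → ℕ := fun x => if A.eval x = 0 then 4 else if B.eval x = 0 then 0 else 5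
    have he (x) : (X - C x) ^ e x ∣ taylorGap A := by
      dsimp only [e]
      split_ifs with h1 h2
      · exact pow_four_dvd_taylorGap h1
      · simp
      · refine pow_five_dvd_taylorGap (by omega) ?_
        have hodd := (Fact.out : p.Prime).eq_two_or_odd
        rw [show (p - 1) / 2 = p / 2 by omega]
        exact (ZMod.pow_div_two_eq_neg_one_or_one p h1).resolve_left
          (fun h' => hnsq x h2 h1 ((ZMod.euler_criterion p h1).mpr h'))
    have hsum := sum_le_natDegree_of_pow_dvd hgap e he
    have hle := natDegree_taylorGap_le (A := A) (d := A.natDegree - 1) (by omega) (by omega)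
    have hlow : 5 * p ≤ ∑ x, e x + A.natDegree + 5 * B.natDegree := by
      have h1 : ∑ x : ZMod p, 5 ≤ ∑ x, (e x + (if A.eval x = 0 then 1 else 0) +
          5 * (if B.eval x = 0 then 1 else 0)) := by
        refine Finset.sum_le_sum fun x _ => ?_
        dsimp only [e]
        split_ifs <;> omega
      rw [Finset.sum_add_distrib, Finset.sum_add_distrib, ← Finset.mul_sum, Finset.sum_boole,
        Finset.sum_boole] at h1
      have hA' := hcard A hA0
      have hB' := hcard B hB0
      simp only [Finset.sum_const, Finset.card_univ, ZMod.card, smul_eq_mul, Nat.cast_id] at h1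
      omega
    omega

end SquareValues

section SingularPencil

open Polynomial

variable {p : ℕ} [Fact p.Prime]

theorem eq_zero_of_sq_eq_nonsquare_mul_sq {F : Type*} [Field F] {ε g e : F} (hε : ¬ IsSquare ε)
    (h : g ^ 2 = ε * e ^ 2) : g = 0 ∧ e = 0 := by
  have he : e = 0 := by
    by_contra he
    exact hε ⟨g / e, by field_simp; exact h.symm⟩
  subst he
  exact ⟨by simpa using h, rfl⟩

theorem dvd_of_dvd_sq_sub_nonsquare_mul_sq {F : Type*} [Field F] {ε x : F} (hε : ¬ IsSquare ε)
    {G E : F[X]} (h : X - C x ∣ G ^ 2 - C ε * E ^ 2) : X - C x ∣ G ∧ X - C x ∣ E := by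
  rw [dvd_iff_isRoot, IsRoot, eval_sub, eval_mul, eval_pow, eval_pow, eval_C, sub_eq_zero] at h
  rw [dvd_iff_isRoot, dvd_iff_isRoot]
  exact eq_zero_of_sq_eq_nonsquare_mul_sq hε h

/-- Every point of the affine curve `t² P(x) + t G(x) + H(x) = 0` is singular. -/
def IsSingularPencil {F : Type*} [Field F] (P G H : F[X]) : Prop :=
  ∀ x t, t ^ 2 * P.eval x + t * G.eval x + H.eval x = 0 →
    2 * t * P.eval x + G.eval x = 0 ∧
      t ^ 2 * (derivative P).eval x + t * (derivative G).eval x + (derivative H).eval x = 0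

theorem IsSingularPencil.exists_discrim (hp : 37 ≤ p) {P G H : (ZMod p)[X]}
    (hP : P.natDegree ≤ 3) (hG : G.natDegree ≤ 4) (hH : H.natDegree ≤ 5)
    (hs : IsSingularPencil P G H) :
    ∃ (ε : ZMod p) (E : (ZMod p)[X]), ¬ IsSquare ε ∧ G ^ 2 - C ε * E ^ 2 = 4 * P * H := by
  have h2 : (2 : ZMod p) ≠ 0 := by
    intro h
    have h' : ((2 : ℕ) : ZMod p) = 0 := by exact_mod_cast h
    have := Nat.le_of_dvd (by omega) ((ZMod.natCast_eq_zero_iff 2 p).mp h')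
    omega
  obtain ⟨ε, E, hε, hE⟩ := exists_eq_nonsquare_mul_sq hp (D := G ^ 2 - 4 * P * H) (by
    have h4 : (4 : (ZMod p)[X]).natDegree ≤ 0 := (natDegree_natCast 4).le
    refine (natDegree_sub_le_of_le (natDegree_pow_le_of_le 2 hG)
      (natDegree_mul_le_of_le (natDegree_mul_le_of_le h4 hP) hH)).trans (by norm_num)) (by
    intro x y hy
    simp only [eval_sub, eval_mul, eval_pow, eval_ofNat] at hy
    by_cases hPx : P.eval x = 0
    · by_cases hGx : G.eval x = 0
      · rw [hPx, hGx] at hy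
        exact pow_eq_zero_iff (two_ne_zero) |>.mp (by linear_combination -hy)
      · have := (hs x (-H.eval x / G.eval x) (by rw [hPx]; field_simp; ring)).1
        rw [hPx, mul_zero, zero_add] at this
        exact absurd this hGx
    · have := (hs x ((y - G.eval x) / (2 * P.eval x)) (by
        field_simp
        linear_combination -hy)).1
      field_simp at this
      linear_combination this)
  exact ⟨ε, E, hε, by linear_combination hE⟩

theorem IsSingularPencil.derivative_eval_eq_zero (hp : 37 ≤ p) {P G H : (ZMod p)[X]}
    (hP : P.natDegree ≤ 3) (hG : G.natDegree ≤ 4) (hH : H.natDegree ≤ 5)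
    (hs : IsSingularPencil P G H) {x : ZMod p} (hx : P.eval x = 0) :
    (derivative P).eval x = 0 := by
  obtain ⟨ε, E, hε, hE⟩ := hs.exists_discrim hp hP hG hH
  by_contra hx'
  obtain ⟨P₁, rfl⟩ := dvd_iff_isRoot.mpr hx
  have hP₁ : P₁.eval x ≠ 0 := by simpa [derivative_mul] using hx'
  obtain ⟨⟨G₁, rfl⟩, ⟨E₁, rfl⟩⟩ := dvd_of_dvd_sq_sub_nonsquare_mul_sq hε
    (show X - C x ∣ G ^ 2 - C ε * E ^ 2 from ⟨4 * P₁ * H, by rw [hE]; ring⟩)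
  have hc : (X - C x) * (G₁ ^ 2 - C ε * E₁ ^ 2) = 4 * P₁ * H :=
    mul_left_cancel₀ (X_sub_C_ne_zero x) (by linear_combination hE)
  have h4 : (4 : ZMod p) ≠ 0 := by
    intro h
    have h' : ((4 : ℕ) : ZMod p) = 0 := by exact_mod_cast h
    have := Nat.le_of_dvd (by omega) ((ZMod.natCast_eq_zero_iff 4 p).mp h')
    omega
  have hHx : H.eval x = 0 := by
    have := congrArg (Polynomial.eval x) hc
    simp only [eval_mul, eval_sub, eval_X, eval_C, sub_self, zero_mul, eval_ofNat] at this
    exact (mul_eq_zero.mp this.symm).resolve_left (mul_ne_zero h4 hP₁)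
  have key (t : ZMod p) := (hs x t (by simp [hHx])).2
  have k0 := key 0
  have k1 := key 1
  have k2 := key (-1)
  have h2 : (2 : ZMod p) ≠ 0 := fun h => h4 (by linear_combination 2 * h)
  refine hx' ((mul_eq_zero.mp ?_).resolve_left h2)
  linear_combination k1 + k2 - 2 * k0

theorem IsSingularPencil.eval_zero_eq_zero (hp : 37 ≤ p) {P G H : (ZMod p)[X]} {α : ZMod p}
    (hα : α ≠ 0) (hP : P = C α * X ^ 3) (hG : G.natDegree ≤ 4) (hH : H.natDegree ≤ 5)
    (hs : IsSingularPencil P G H) : H.eval 0 = 0 := by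
  obtain ⟨ε, E, hε, hE⟩ := hs.exists_discrim hp (hP ▸ natDegree_C_mul_X_pow_le α 3) hG hH
  subst hP
  have hX : (X : (ZMod p)[X]) - C 0 = X := by simp
  have hdvd {G E : (ZMod p)[X]} (h : X ∣ G ^ 2 - C ε * E ^ 2) : X ∣ G ∧ X ∣ E := by
    simpa only [hX] using dvd_of_dvd_sq_sub_nonsquare_mul_sq (x := 0) hε (by rwa [hX])
  obtain ⟨⟨G₁, rfl⟩, ⟨E₁, rfl⟩⟩ := hdvd (G := G) (E := E)
    ⟨4 * C α * X ^ 2 * H, by rw [hE]; ring⟩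
  have hc₁ : G₁ ^ 2 - C ε * E₁ ^ 2 = 4 * C α * X * H :=
    mul_left_cancel₀ (pow_ne_zero 2 X_ne_zero) (by linear_combination hE)
  obtain ⟨⟨G₂, rfl⟩, ⟨E₂, rfl⟩⟩ := hdvd (G := G₁) (E := E₁)
    ⟨4 * C α * H, by rw [hc₁]; ring⟩
  have hc₂ : X * (G₂ ^ 2 - C ε * E₂ ^ 2) = 4 * C α * H :=
    mul_left_cancel₀ X_ne_zero (by linear_combination hc₁)
  have h4 : (4 : ZMod p) ≠ 0 := by
    intro h
    have h' : ((4 : ℕ) : ZMod p) = 0 := by exact_mod_cast h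
    have := Nat.le_of_dvd (by omega) ((ZMod.natCast_eq_zero_iff 4 p).mp h')
    omega
  have := congrArg (Polynomial.eval 0) hc₂
  simp only [eval_mul, eval_X, eval_C, zero_mul, eval_ofNat] at this
  exact (mul_eq_zero.mp this.symm).resolve_left (mul_ne_zero h4 hα)

end SingularPencil

section LineRestriction

open MvPolynomial

variable {R : Type*} [CommRing R] {N : ℕ}

/-- The restriction `t ↦ P (v + t a)` of a polynomial to a line. -/
noncomputable def lineRestrict (P : MvPolynomial (Fin N) R) (v a : Fin N → R) : Polynomial R :=
  aeval (fun i => Polynomial.C (v i) + Polynomial.C (a i) * Polynomial.X) P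

theorem eval_lineRestrict (P : MvPolynomial (Fin N) R) (v a : Fin N → R) (t : R) :
    (lineRestrict P v a).eval t = eval (v + t • a) P := by
  have h : (Polynomial.evalRingHom t).comp (aeval (R := R) fun i : Fin N =>
      Polynomial.C (v i) + Polynomial.C (a i) * Polynomial.X).toRingHom = eval (v + t • a) := by
    refine ringHom_ext (fun r => ?_) (fun i => ?_)
    · change Polynomial.eval t (aeval _ (C r)) = _
      rw [aeval_C, ← Polynomial.C_eq_algebraMap, Polynomial.eval_C, eval_C]
    · change Polynomial.eval t (aeval _ (X i)) = _
      simp only [aeval_X, eval_X, Polynomial.eval_add, Polynomial.eval_mul, Polynomial.eval_C,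
        Polynomial.eval_X, Pi.add_apply, Pi.smul_apply, smul_eq_mul]
      ring
  exact RingHom.congr_fun h P

/-- The coefficient of `tᵏ` in `P (v + t a)`, as a polynomial in `v`. -/
noncomputable def polar (k : ℕ) (P : MvPolynomial (Fin N) R) (a : Fin N → R) :
    MvPolynomial (Fin N) R :=
  (finSuccEquiv R N (aeval (fun i => X i.succ + C (a i) * X 0) P)).coeff k

theorem isHomogeneous_line {P : MvPolynomial (Fin N) R} {d : ℕ} (hP : P.IsHomogeneous d)
    (a : Fin N → R) :
    (aeval (fun i => (X i.succ + C (a i) * X 0 : MvPolynomial (Fin (N + 1)) R)) P).IsHomogeneous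
      d := by
  simpa using hP.aeval (n := 1) (fun i => (X i.succ + C (a i) * X 0 : MvPolynomial _ R))
    (fun i => (isHomogeneous_X R _).add ((isHomogeneous_X R _).C_mul _))

theorem polar_isHomogeneous {P : MvPolynomial (Fin N) R} {d k j : ℕ} (hP : P.IsHomogeneous d)
    (a : Fin N → R) (h : k + j = d) : (polar k P a).IsHomogeneous j :=
  (isHomogeneous_line hP a).finSuccEquiv_coeff_isHomogeneous k j h

theorem lineRestrict_eq_map (P : MvPolynomial (Fin N) R) (v a : Fin N → R) :
    lineRestrict P v a =
      (finSuccEquiv R N (aeval (fun i => X i.succ + C (a i) * X 0) P)).map (eval v) := by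
  have h : (aeval (R := R) fun i : Fin N =>
      Polynomial.C (v i) + Polynomial.C (a i) * Polynomial.X).toRingHom =
      (Polynomial.mapRingHom (eval v)).comp ((finSuccEquiv R N).toRingEquiv.toRingHom.comp
        (aeval (R := R) fun i : Fin N =>
          (X i.succ + C (a i) * X 0 : MvPolynomial _ R)).toRingHom) := by
    refine ringHom_ext (fun r => ?_) (fun i => ?_)
    · simp [finSuccEquiv_apply]
    · simp [finSuccEquiv_apply]
  exact RingHom.congr_fun h P

theorem eval_polar (k : ℕ) (P : MvPolynomial (Fin N) R) (v a : Fin N → R) :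
    eval v (polar k P a) = (lineRestrict P v a).coeff k := by
  rw [lineRestrict_eq_map, Polynomial.coeff_map, polar]

theorem natDegree_lineRestrict_le {P : MvPolynomial (Fin N) R} {d : ℕ} (hP : P.IsHomogeneous d)
    (v a : Fin N → R) : (lineRestrict P v a).natDegree ≤ d := by
  rw [lineRestrict_eq_map]
  refine Polynomial.natDegree_map_le.trans ?_
  rw [natDegree_finSuccEquiv]
  exact (degreeOf_le_totalDegree _ _).trans (isHomogeneous_line hP a).totalDegree_le

theorem MvPolynomial.IsHomogeneous.eval_smul_eq {P : MvPolynomial (Fin N) R} {d : ℕ}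
    (hP : P.IsHomogeneous d) (t : R) (v : Fin N → R) :
    eval (t • v) P = t ^ d * eval v P := by
  rw [eval_eq', eval_eq', Finset.mul_sum]
  refine Finset.sum_congr rfl fun m hm => ?_
  have hd : ∑ i, m i = d := by
    rw [← hP (mem_support_iff.mp hm), ← Finsupp.degree_eq_sum]
    exact DFunLike.congr_fun Finsupp.degree_eq_weight_one m
  simp only [Pi.smul_apply, smul_eq_mul, mul_pow, Finset.prod_mul_distrib,
    Finset.prod_pow_eq_pow_sum, hd]
  ring

theorem MvPolynomial.IsHomogeneous.eval_zero_eq {P : MvPolynomial (Fin N) R} {d : ℕ}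
    (hP : P.IsHomogeneous d) (hd : d ≠ 0) : eval 0 P = 0 := by
  simpa [hd] using hP.eval_smul_eq 0 0

end LineRestriction

section ZModLine

open MvPolynomial

variable {p : ℕ} [Fact p.Prime] {N : ℕ}

theorem polynomial_ext_zmod {P Q : Polynomial (ZMod p)} {d : ℕ} (hP : P.natDegree ≤ d)
    (hQ : Q.natDegree ≤ d) (hd : d < p) (h : ∀ x, P.eval x = Q.eval x) : P = Q :=
  Polynomial.eq_of_natDegree_lt_card_of_eval_eq P Q Function.injective_id h (by
    rw [ZMod.card]; exact (max_le hP hQ).trans_lt hd)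

theorem coeff_lineRestrict_symm {P : MvPolynomial (Fin N) (ZMod p)} {d : ℕ}
    (hP : P.IsHomogeneous d) (hd : d + 1 < p) (v a : Fin N → ZMod p) {j k : ℕ} (hjk : j + k = d) :
    (lineRestrict P v a).coeff j = (lineRestrict P a v).coeff k := by
  have hv := natDegree_lineRestrict_le hP v a
  have ha := natDegree_lineRestrict_le hP a v
  have key : lineRestrict P v a * Polynomial.X =
      Polynomial.reflect d (lineRestrict P a v) * Polynomial.X := by
    have hr : (Polynomial.reflect d (lineRestrict P a v)).natDegree ≤ d :=
      (Polynomial.natDegree_reflect_le ..).trans (max_le le_rfl ha)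
    refine polynomial_ext_zmod (d := d + 1)
      (Polynomial.natDegree_mul_le_of_le hv Polynomial.natDegree_X_le)
      (Polynomial.natDegree_mul_le_of_le hr Polynomial.natDegree_X_le) hd fun t => ?_
    by_cases ht : t = 0
    · simp [ht]
    · let := invertibleOfNonzero (inv_ne_zero ht)
      have h := Polynomial.eval₂_reflect_mul_pow (RingHom.id _) t⁻¹ d (lineRestrict P a v) ha
      rw [invOf_eq_inv, inv_inv] at h
      change Polynomial.eval _ _ * _ = Polynomial.eval _ _ at h
      rw [eval_lineRestrict] at h
      have h2 := hP.eval_smul_eq t (a + t⁻¹ • v)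
      rw [smul_add, smul_smul, mul_inv_cancel₀ ht, one_smul] at h2
      rw [Polynomial.eval_mul, Polynomial.eval_mul, Polynomial.eval_X, eval_lineRestrict,
        add_comm v, h2, ← h, inv_pow]
      field_simp
  have := congrArg (fun Q => Polynomial.coeff Q (j + 1)) key
  simp only [Polynomial.coeff_mul_X, Polynomial.coeff_reflect] at this
  rw [this, ← hjk, Polynomial.revAt_le (by omega)]
  congr 1
  omega

end ZModLine

section SingularForm

open MvPolynomial Module

variable {p : ℕ} [Fact p.Prime] {N : ℕ}

theorem exists_ne_zero_mem_common_zero {ι : Type*} [Fintype ι]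
    (P : ι → MvPolynomial (Fin N) (ZMod p)) (d : ι → ℕ) (hP : ∀ i, (P i).IsHomogeneous (d i))
    (hd : ∀ i, d i ≠ 0) (W : Submodule (ZMod p) (Fin N → ZMod p))
    (h : ∑ i, d i < finrank (ZMod p) W) :
    ∃ x ∈ W, x ≠ 0 ∧ ∀ i, eval x (P i) = 0 := by
  classical
  let b := finBasis (ZMod p) W
  let l : Fin N → MvPolynomial (Fin (finrank (ZMod p) W)) (ZMod p) :=
    fun j => ∑ k, C ((b k : Fin N → ZMod p) j) * X k
  have hl (j) : (l j).IsHomogeneous 1 :=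
    IsHomogeneous.sum _ _ _ fun k _ => (isHomogeneous_X _ k).C_mul _
  have hQ (i) : (aeval l (P i)).IsHomogeneous (d i) := by
    simpa using (hP i).aeval l hl
  have heval (i) (y) :
      eval y (aeval l (P i)) = eval ((b.equivFun.symm y : W) : Fin N → ZMod p) (P i) := by
    rw [aeval_def, ← coe_eval₂Hom, map_eval₂Hom]
    simp only [coe_eval₂Hom]
    rw [show (eval y).comp (algebraMap (ZMod p) (MvPolynomial _ (ZMod p))) = RingHom.id _ from
      RingHom.ext fun r => eval_C r, ← eval₂_id (g := _)]
    congr 1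
    ext j
    simp [l, Basis.equivFun_symm_apply, mul_comm]
  have hdvd := char_dvd_card_solutions_of_fintype_sum_lt p (K := ZMod p)
    (f := fun i => aeval l (P i)) (by
      rw [Fintype.card_fin]
      exact (Finset.sum_le_sum fun i _ => (hQ i).totalDegree_le).trans_lt h)
  let y₀ : {y : Fin (finrank (ZMod p) W) → ZMod p // ∀ i, eval y (aeval l (P i)) = 0} :=
    ⟨0, fun i => (hQ i).eval_zero_eq (hd i)⟩
  have hcard : 1 < Fintype.card
      {y : Fin (finrank (ZMod p) W) → ZMod p // ∀ i, eval y (aeval l (P i)) = 0} :=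
    (Fact.out : p.Prime).one_lt.trans_le
      (Nat.le_of_dvd (Fintype.card_pos_iff.mpr ⟨y₀⟩) hdvd)
  obtain ⟨y, hy⟩ := Fintype.exists_ne_of_one_lt_card hcard y₀
  refine ⟨(b.equivFun.symm y.1 : W), SetLike.coe_mem _, fun h0 => hy (Subtype.ext ?_),
    fun i => by rw [← heval]; exact y.2 i⟩
  exact (LinearEquiv.map_eq_zero_iff b.equivFun.symm).mp (Subtype.ext h0)

/-- Every zero of `f` is a singular zero: `f` restricted to a line has no simple roots. -/
def IsSingularForm (f : MvPolynomial (Fin N) (ZMod p)) : Prop :=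
  ∀ v a t, (lineRestrict f v a).eval t = 0 → (lineRestrict f v a).derivative.eval t = 0

theorem coeff_zero_lineRestrict {R : Type*} [CommRing R] (P : MvPolynomial (Fin N) R)
    (v a : Fin N → R) : (lineRestrict P v a).coeff 0 = eval v P := by
  rw [Polynomial.coeff_zero_eq_eval_zero, eval_lineRestrict, zero_smul, add_zero]

theorem coeff_lineRestrict_degree {P : MvPolynomial (Fin N) (ZMod p)} {d : ℕ}
    (hP : P.IsHomogeneous d) (hd : d + 1 < p) (v a : Fin N → ZMod p) :
    (lineRestrict P v a).coeff d = eval a P := by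
  rw [coeff_lineRestrict_symm hP hd v a (add_zero d), coeff_zero_lineRestrict]

variable {f : MvPolynomial (Fin N) (ZMod p)}

theorem IsSingularForm.coeff_one (hs : IsSingularForm f) {v : Fin N → ZMod p} (hv : eval v f = 0)
    (a : Fin N → ZMod p) : (lineRestrict f v a).coeff 1 = 0 := by
  have h := hs v a 0 (by simpa [eval_lineRestrict] using hv)
  simpa [← Polynomial.coeff_zero_eq_eval_zero, Polynomial.coeff_derivative] using h

theorem IsSingularForm.eval_add_smul (hp : 7 < p) (hf : f.IsHomogeneous 5) (hs : IsSingularForm f)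
    {a : Fin N → ZMod p} (ha : eval a f = 0) (v : Fin N → ZMod p) (t : ZMod p) :
    eval (v + t • a) f = t ^ 3 * eval v (polar 3 f a) + t ^ 2 * eval v (polar 2 f a) +
      t * eval v (polar 1 f a) + eval v f := by
  have hdeg := natDegree_lineRestrict_le hf v a
  rw [← eval_lineRestrict, Polynomial.eval_eq_sum_range' (n := 6) (by omega)]
  simp only [Finset.sum_range_succ, Finset.sum_range_zero, eval_polar, coeff_zero_lineRestrict]
  rw [coeff_lineRestrict_degree hf (by omega), ha,
    coeff_lineRestrict_symm hf (by omega) v a (show 4 + 1 = 5 from rfl), hs.coeff_one ha]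
  ring

theorem IsSingularForm.lineRestrict_add_smul (hp : 7 < p) (hf : f.IsHomogeneous 5)
    (hs : IsSingularForm f) {a : Fin N → ZMod p} (ha : eval a f = 0) (w u : Fin N → ZMod p)
    (t : ZMod p) :
    lineRestrict f (w + t • a) u = Polynomial.C (t ^ 3) * lineRestrict (polar 3 f a) w u +
      Polynomial.C (t ^ 2) * lineRestrict (polar 2 f a) w u +
      Polynomial.C t * lineRestrict (polar 1 f a) w u + lineRestrict f w u := by
  have h3 := natDegree_lineRestrict_le (polar_isHomogeneous hf a (show 3 + 2 = 5 from rfl)) w u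
  have h2 := natDegree_lineRestrict_le (polar_isHomogeneous hf a (show 2 + 3 = 5 from rfl)) w u
  have h1 := natDegree_lineRestrict_le (polar_isHomogeneous hf a (show 1 + 4 = 5 from rfl)) w u
  refine polynomial_ext_zmod (d := 5) (natDegree_lineRestrict_le hf _ _) ?_ (by omega)
    fun x => ?_
  · refine Polynomial.natDegree_add_le_of_degree_le (Polynomial.natDegree_add_le_of_degree_le
      (Polynomial.natDegree_add_le_of_degree_le ?_ ?_) ?_) (natDegree_lineRestrict_le hf _ _) <;>
    exact (Polynomial.natDegree_C_mul_le _ _).trans (by omega)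
  · simp only [Polynomial.eval_add, Polynomial.eval_mul, Polynomial.eval_C, eval_lineRestrict]
    rw [add_right_comm, hs.eval_add_smul hp hf ha]

theorem IsSingularForm.isSingularPencil (hp : 7 < p) (hf : f.IsHomogeneous 5)
    (hs : IsSingularForm f) {a : Fin N → ZMod p} (ha : eval a f = 0) {w u : Fin N → ZMod p}
    (hq : ∀ x : ZMod p, eval (w + x • u) (polar 3 f a) = 0) :
    IsSingularPencil (lineRestrict (polar 2 f a) w u) (lineRestrict (polar 1 f a) w u)
      (lineRestrict f w u) := by
  intro x t h
  simp only [eval_lineRestrict] at h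
  have hzero : eval (w + x • u + t • a) f = 0 := by
    rw [hs.eval_add_smul hp hf ha, hq]
    linear_combination h
  constructor
  · have hline : lineRestrict f (w + x • u) a =
        Polynomial.C (eval (w + x • u) (polar 2 f a)) * Polynomial.X ^ 2 +
        Polynomial.C (eval (w + x • u) (polar 1 f a)) * Polynomial.X +
        Polynomial.C (eval (w + x • u) f) := by
      refine polynomial_ext_zmod (d := 5) (natDegree_lineRestrict_le hf _ _) ?_ (by omega)
        fun s => ?_
      · exact Polynomial.natDegree_quadratic_le.trans (by omega)
      · rw [eval_lineRestrict, hs.eval_add_smul hp hf ha, hq]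
        simp only [Polynomial.eval_add, Polynomial.eval_mul, Polynomial.eval_C,
          Polynomial.eval_pow, Polynomial.eval_X]
        ring
    have := hs (w + x • u) a t (by rwa [eval_lineRestrict])
    rw [hline] at this
    simp only [Polynomial.derivative_add, Polynomial.derivative_mul, Polynomial.derivative_C,
      Polynomial.derivative_X_pow, Polynomial.derivative_X, Polynomial.eval_add,
      Polynomial.eval_mul, Polynomial.eval_C, Polynomial.eval_pow, Polynomial.eval_X,
      Polynomial.eval_zero, Polynomial.eval_one, Nat.cast_ofNat] at this
    rw [eval_lineRestrict, eval_lineRestrict]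
    linear_combination this
  · have h0 : lineRestrict (polar 3 f a) w u = 0 :=
      polynomial_ext_zmod (d := 5) ((natDegree_lineRestrict_le
        (polar_isHomogeneous hf a (show 3 + 2 = 5 from rfl)) w u).trans (by omega)) (by simp)
        (by omega) fun s => by rw [eval_lineRestrict, hq, Polynomial.eval_zero]
    have := hs (w + t • a) u x (by rwa [eval_lineRestrict, add_right_comm])
    rw [hs.lineRestrict_add_smul hp hf ha, h0] at this
    simpa only [mul_zero, zero_add, Polynomial.derivative_add, Polynomial.derivative_C_mul,
      Polynomial.eval_add, Polynomial.eval_C_mul] using this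

end SingularForm

section ZeroSubspace

open MvPolynomial Module

variable {p : ℕ} [Fact p.Prime] {N : ℕ} {f : MvPolynomial (Fin N) (ZMod p)}

theorem IsSingularForm.coeff_one_polar_two (hp : 37 ≤ p) (hf : f.IsHomogeneous 5)
    (hs : IsSingularForm f) {a w u : Fin N → ZMod p} (ha : eval a f = 0)
    (hq : ∀ x : ZMod p, eval (w + x • u) (polar 3 f a) = 0) {x : ZMod p}
    (hc : eval (w + x • u) (polar 2 f a) = 0) :
    (lineRestrict (polar 2 f a) w u).derivative.eval x = 0 :=
  (hs.isSingularPencil (by omega) hf ha hq).derivative_eval_eq_zero hp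
    (natDegree_lineRestrict_le (polar_isHomogeneous hf a rfl) w u)
    (natDegree_lineRestrict_le (polar_isHomogeneous hf a rfl) w u)
    (natDegree_lineRestrict_le hf w u) (by rwa [eval_lineRestrict])

theorem lineRestrict_cubic (hp : 7 < p) {P : MvPolynomial (Fin N) (ZMod p)}
    (hP : P.IsHomogeneous 3) (w u : Fin N → ZMod p) :
    lineRestrict P w u = Polynomial.C (eval u P) * Polynomial.X ^ 3 +
      Polynomial.C ((lineRestrict P w u).coeff 2) * Polynomial.X ^ 2 +
      Polynomial.C ((lineRestrict P w u).coeff 1) * Polynomial.X + Polynomial.C (eval w P) := by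
  have hdeg := natDegree_lineRestrict_le hP w u
  conv_lhs =>
    rw [Polynomial.as_sum_range_C_mul_X_pow' (p := lineRestrict P w u) (n := 4) (by omega)]
  simp only [Finset.sum_range_succ, Finset.sum_range_zero, coeff_zero_lineRestrict,
    coeff_lineRestrict_degree hP (show 3 + 1 < p by omega)]
  ring

theorem IsSingularForm.polar_two_eq_zero (hp : 37 ≤ p) (hf : f.IsHomogeneous 5)
    (hs : IsSingularForm f) {a w u : Fin N → ZMod p} (ha : eval a f = 0)
    (hq : ∀ s x : ZMod p, eval (s • w + x • u) (polar 3 f a) = 0)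
    (hw : eval w (polar 2 f a) = 0) (hu : eval u (polar 2 f a) = 0) (x : ZMod p) :
    eval (w + x • u) (polar 2 f a) = 0 := by
  have hc : (polar 2 f a).IsHomogeneous 3 := polar_isHomogeneous hf a rfl
  have key {w u : Fin N → ZMod p} (hq : ∀ s x : ZMod p, eval (s • w + x • u) (polar 3 f a) = 0)
      (hw : eval w (polar 2 f a) = 0) : (lineRestrict (polar 2 f a) w u).coeff 1 = 0 := by
    have := hs.coeff_one_polar_two hp hf ha (w := w) (u := u) (x := 0)
      (fun x => by simpa using hq 1 x) (by simpa using hw)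
    simpa [← Polynomial.coeff_zero_eq_eval_zero, Polynomial.coeff_derivative] using this
  have h2 : (lineRestrict (polar 2 f a) w u).coeff 2 = 0 := by
    rw [coeff_lineRestrict_symm hc (by omega) w u (show 2 + 1 = 3 from rfl)]
    exact key (fun s x => by rw [add_comm]; exact hq x s) hu
  rw [← eval_lineRestrict, lineRestrict_cubic (by omega) hc, key hq hw, h2, hw, hu]
  simp

theorem IsSingularForm.eval_eq_zero_of_polar_two_ne_zero (hp : 37 ≤ p) (hf : f.IsHomogeneous 5)
    (hs : IsSingularForm f) {a w u : Fin N → ZMod p} (ha : eval a f = 0)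
    (hq : ∀ x : ZMod p, eval (w + x • u) (polar 3 f a) = 0)
    (hw : eval w (polar 2 f a) = 0) (hu : eval u (polar 2 f a) ≠ 0) : eval w f = 0 := by
  have hc : (polar 2 f a).IsHomogeneous 3 := polar_isHomogeneous hf a rfl
  have h1 : (lineRestrict (polar 2 f a) w u).coeff 1 = 0 := by
    have := hs.coeff_one_polar_two hp hf ha (w := w) (u := u) (x := 0) hq (by simpa using hw)
    simpa [← Polynomial.coeff_zero_eq_eval_zero, Polynomial.coeff_derivative] using this
  have hcub := lineRestrict_cubic (by omega) hc w u
  rw [h1, hw] at hcub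
  set γ := (lineRestrict (polar 2 f a) w u).coeff 2
  set α := eval u (polar 2 f a)
  have hγ : γ = 0 := by
    have := hs.coeff_one_polar_two hp hf ha (w := w) (u := u) (x := -γ / α) hq (by
      rw [← eval_lineRestrict, hcub]
      simp only [Polynomial.eval_add, Polynomial.eval_mul, Polynomial.eval_C,
        Polynomial.eval_pow, Polynomial.eval_X]
      field_simp
      ring)
    rw [hcub] at this
    simp only [Polynomial.derivative_add, Polynomial.derivative_C_mul, Polynomial.derivative_C,
      Polynomial.derivative_X_pow, Polynomial.derivative_X, Polynomial.eval_add,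
      Polynomial.eval_mul, Polynomial.eval_C, Polynomial.eval_pow, Polynomial.eval_X,
      Polynomial.eval_one, Nat.cast_ofNat, Nat.reduceSub, pow_one, zero_mul,
      add_zero] at this
    field_simp at this
    have h2 : γ ^ 2 = 0 := by linear_combination this
    exact pow_eq_zero_iff two_ne_zero |>.mp h2
  rw [hγ] at hcub
  have := (hs.isSingularPencil (by omega) hf ha hq).eval_zero_eq_zero hp hu
    (by rw [hcub]; simp) (natDegree_lineRestrict_le (polar_isHomogeneous hf a rfl) w u)
    (natDegree_lineRestrict_le hf w u)
  rwa [eval_lineRestrict, zero_smul, add_zero] at this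

theorem coeffs_eq_zero_of_cubic_eq_zero (hp : 7 < p) {A B D E : ZMod p}
    (h : ∀ t : ZMod p, t ^ 3 * A + t ^ 2 * B + t * D + E = 0) : A = 0 ∧ B = 0 := by
  have : Polynomial.C A * Polynomial.X ^ 3 + Polynomial.C B * Polynomial.X ^ 2 +
      Polynomial.C D * Polynomial.X + Polynomial.C E = 0 :=
    polynomial_ext_zmod (d := 3) Polynomial.natDegree_cubic_le (by simp) (by omega) fun t => by
      simp only [Polynomial.eval_add, Polynomial.eval_mul, Polynomial.eval_C,
        Polynomial.eval_pow, Polynomial.eval_X, Polynomial.eval_zero]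
      linear_combination h t
  exact ⟨by
      simpa [Polynomial.coeff_X, Polynomial.coeff_C] using congrArg (Polynomial.coeff · 3) this,
    by simpa [Polynomial.coeff_X, Polynomial.coeff_C] using congrArg (Polynomial.coeff · 2) this⟩

theorem eval_smul_add_smul_quadratic (hp : 7 < p) {Q : MvPolynomial (Fin N) (ZMod p)}
    (hQ : Q.IsHomogeneous 2) (w u : Fin N → ZMod p) (s x : ZMod p) :
    eval (s • w + x • u) Q =
      s ^ 2 * eval w Q + s * x * eval w (polar 1 Q u) + x ^ 2 * eval u Q := by
  have hdeg := natDegree_lineRestrict_le hQ (s • w) u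
  rw [← eval_lineRestrict, Polynomial.eval_eq_sum_range' (n := 3) (by omega)]
  simp only [Finset.sum_range_succ, Finset.sum_range_zero, coeff_zero_lineRestrict,
    coeff_lineRestrict_degree hQ (show 2 + 1 < p by omega)]
  rw [← eval_polar, (polar_isHomogeneous hQ u (show 1 + 1 = 2 from rfl)).eval_smul_eq,
    hQ.eval_smul_eq]
  ring

theorem IsSingularForm.eval_polar_of_mem (hp : 37 ≤ p) (hf : f.IsHomogeneous 5)
    (hs : IsSingularForm f) {L : Submodule (ZMod p) (Fin N → ZMod p)}
    (hL : ∀ x ∈ L, eval x f = 0) {a l : Fin N → ZMod p} (ha : a ∈ L) (hl : l ∈ L) :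
    eval l (polar 2 f a) = 0 ∧
      ∀ (v : Fin N → ZMod p) (x : ZMod p),
        eval (l + x • v) (polar 3 f a) = x ^ 2 * eval v (polar 3 f a) := by
  have hla (t : ZMod p) : eval (l + t • a) f = 0 := hL _ (L.add_mem hl (L.smul_mem t ha))
  obtain ⟨h3, h2⟩ := coeffs_eq_zero_of_cubic_eq_zero (p := p) (by omega) fun t =>
    (hs.eval_add_smul (by omega) hf (hL a ha) l t).symm.trans (hla t)
  refine ⟨h2, fun v x => ?_⟩
  have h1 : eval l (polar 1 (polar 3 f a) v) = 0 := by
    rw [eval_polar]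
    refine (coeffs_eq_zero_of_cubic_eq_zero (p := p) (by omega)
      (B := (lineRestrict (polar 2 f a) l v).coeff 1)
      (D := (lineRestrict (polar 1 f a) l v).coeff 1)
      (E := (lineRestrict f l v).coeff 1) fun t => ?_).1
    have := hs.coeff_one (hla t) v
    rw [hs.lineRestrict_add_smul (by omega) hf (hL a ha)] at this
    simpa only [Polynomial.coeff_add, Polynomial.coeff_C_mul] using this
  have := eval_smul_add_smul_quadratic (by omega)
    (polar_isHomogeneous hf a (show 3 + 2 = 5 from rfl)) l v 1 x
  rw [one_smul, h1, h3] at this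
  rw [this]
  ring

theorem IsSingularForm.eval_eq_zero_of_mem_sup (hp : 37 ≤ p) (hf : f.IsHomogeneous 5)
    (hs : IsSingularForm f) {L : Submodule (ZMod p) (Fin N → ZMod p)}
    (hL : ∀ x ∈ L, eval x f = 0) {a v v' : Fin N → ZMod p} (ha : a ∈ L)
    (hqv : eval v (polar 3 f a) = 0) (hqv' : eval v' (polar 3 f a) = 0)
    (hvv' : eval v (polar 1 (polar 3 f a) v') = 0)
    (hcv : eval v (polar 2 f a) = 0) (hcv' : eval v' (polar 2 f a) ≠ 0) :
    ∀ x ∈ L ⊔ Submodule.span (ZMod p) {v}, eval x f = 0 := by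
  intro z hz
  obtain ⟨l, hl, _, hy, rfl⟩ := Submodule.mem_sup.mp hz
  obtain ⟨y, rfl⟩ := Submodule.mem_span_singleton.mp hy
  refine hs.eval_eq_zero_of_polar_two_ne_zero hp hf (hL a ha) (u := v') (fun x => ?_) ?_ hcv'
  · have := (hs.eval_polar_of_mem hp hf hL ha hl).2 (y • v + x • v') 1
    rw [one_smul, ← add_assoc] at this
    rw [this, eval_smul_add_smul_quadratic (by omega)
      (polar_isHomogeneous hf a (show 3 + 2 = 5 from rfl)), hqv, hqv', hvv']
    ring
  · refine hs.polar_two_eq_zero hp hf (hL a ha) (fun s x => ?_)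
      (hs.eval_polar_of_mem hp hf hL ha hl).1 hcv y
    rw [(hs.eval_polar_of_mem hp hf hL ha (L.smul_mem s hl)).2, hqv, mul_zero]

theorem IsSingularForm.polar_two_eq_zero_of_polar_three_eq_zero (hp : 37 ≤ p)
    (hf : f.IsHomogeneous 5) (hs : IsSingularForm f)
    (hno : ∀ L : Submodule (ZMod p) (Fin N → ZMod p), (∀ x ∈ L, eval x f = 0) →
      finrank (ZMod p) L + 6 ≤ N)
    {a : Fin N → ZMod p} (ha : eval a f = 0) {v : Fin N → ZMod p}
    (hv : eval v (polar 3 f a) = 0) : eval v (polar 2 f a) = 0 := by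
  by_contra hcv
  obtain ⟨L, ⟨haL, hL⟩, hmax⟩ := wellFounded_gt.has_min
    {L : Submodule (ZMod p) (Fin N → ZMod p) | a ∈ L ∧ ∀ x ∈ L, eval x f = 0}
    ⟨Submodule.span (ZMod p) {a}, Submodule.mem_span_singleton_self a, fun x hx => by
      obtain ⟨t, rfl⟩ := Submodule.mem_span_singleton.mp hx
      rw [hf.eval_smul_eq, ha, mul_zero]⟩
  obtain ⟨W, hW⟩ := Submodule.exists_isCompl L
  have hdim := Submodule.finrank_add_eq_of_isCompl hW
  rw [finrank_fin_fun] at hdim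
  have hLN := hno L hL
  have hq : (polar 3 f a).IsHomogeneous 2 := polar_isHomogeneous hf a rfl
  have hc : (polar 2 f a).IsHomogeneous 3 := polar_isHomogeneous hf a rfl
  have ext {u v' : Fin N → ZMod p} (huW : u ∈ W) (hu0 : u ≠ 0)
      (hqu : eval u (polar 3 f a) = 0) (hqv' : eval v' (polar 3 f a) = 0)
      (huv' : eval u (polar 1 (polar 3 f a) v') = 0)
      (hcu : eval u (polar 2 f a) = 0) (hcv' : eval v' (polar 2 f a) ≠ 0) : False := by
    refine hmax (L ⊔ Submodule.span (ZMod p) {u}) ⟨Submodule.mem_sup_left haL,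
      hs.eval_eq_zero_of_mem_sup hp hf hL haL hqu hqv' huv' hcu hcv'⟩ ?_
    refine lt_of_le_of_ne le_sup_left fun h => hu0 ?_
    have huL : u ∈ L := by
      rw [h]
      exact Submodule.mem_sup_right (Submodule.mem_span_singleton_self u)
    exact Submodule.disjoint_def.mp hW.disjoint u huL huW
  obtain ⟨u, huW, hu0, hu⟩ := exists_ne_zero_mem_common_zero
    ![polar 3 f a, polar 2 f a] ![2, 3] (by simp [Fin.forall_fin_two, hq, hc])
    (by simp [Fin.forall_fin_two]) W (by simp; omega)
  simp only [Fin.forall_fin_two, Matrix.cons_val_zero, Matrix.cons_val_one] at hu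
  obtain ⟨hqu, hcu⟩ := hu
  have hlin (y : Fin N → ZMod p) : (polar 1 (polar 3 f a) y).IsHomogeneous 1 :=
    polar_isHomogeneous hq y rfl
  obtain ⟨w, hwW, hw0, hw⟩ := exists_ne_zero_mem_common_zero
    ![polar 1 (polar 3 f a) u, polar 1 (polar 3 f a) v, polar 3 f a] ![1, 1, 2]
    (by simp [Fin.forall_fin_succ, hq, hlin]) (by simp [Fin.forall_fin_succ]) W
    (by simp [Fin.sum_univ_succ]; omega)
  have hwu : eval w (polar 1 (polar 3 f a) u) = 0 := hw 0
  have hwv : eval w (polar 1 (polar 3 f a) v) = 0 := hw 1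
  have hqw : eval w (polar 3 f a) = 0 := hw 2
  by_cases hcw : eval w (polar 2 f a) = 0
  · exact ext hwW hw0 hqw hv hwv hcw hcv
  · refine ext huW hu0 hqu hqw ?_ hcu hcw
    rw [eval_polar, coeff_lineRestrict_symm hq (by omega) u w (show 1 + 1 = 2 from rfl),
      ← eval_polar, hwu]

/-- A quintic form over `𝔽_p` all of whose zeros are singular vanishes on a subspace of codimension
at most `5`. -/
theorem IsSingularForm.exists_submodule (hp : 37 ≤ p) (hf : f.IsHomogeneous 5)
    (hs : IsSingularForm f) :
    ∃ W : Submodule (ZMod p) (Fin N → ZMod p), N ≤ finrank (ZMod p) W + 5 ∧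
      ∀ x ∈ W, eval x f = 0 := by
  by_contra! hno
  have hno' (L : Submodule (ZMod p) (Fin N → ZMod p)) (hL : ∀ x ∈ L, eval x f = 0) :
      finrank (ZMod p) L + 6 ≤ N := by
    by_contra h
    obtain ⟨x, hx, hx0⟩ := hno L (by omega)
    exact hx0 (hL x hx)
  have hsymm (a b : Fin N → ZMod p) : eval b (polar 2 f a) = eval a (polar 3 f b) := by
    rw [eval_polar, eval_polar, coeff_lineRestrict_symm hf (by omega) b a (show 2 + 3 = 5 from rfl)]
  have hadd {a b : Fin N → ZMod p} (ha : eval a f = 0) (hb : eval b f = 0) :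
      eval (a + b) f = 0 := by
    have hexp (t : ZMod p) := hs.eval_add_smul (by omega) hf ha b t
    have hg : eval b (polar 1 f a) = 0 := by rw [eval_polar, hs.coeff_one hb]
    rw [hg, hb] at hexp
    have hboth : eval b (polar 3 f a) = 0 ∧ eval b (polar 2 f a) = 0 := by
      by_cases hq : eval b (polar 3 f a) = 0
      · exact ⟨hq, hs.polar_two_eq_zero_of_polar_three_eq_zero hp hf hno' ha hq⟩
      by_cases hc : eval b (polar 2 f a) = 0
      · refine absurd ?_ hq
        rw [← hsymm]
        exact hs.polar_two_eq_zero_of_polar_three_eq_zero hp hf hno' hb (by rw [← hsymm, hc])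
      exfalso
      have hline : lineRestrict f b a =
          Polynomial.C (eval b (polar 3 f a)) * Polynomial.X ^ 3 +
          Polynomial.C (eval b (polar 2 f a)) * Polynomial.X ^ 2 + 0 * Polynomial.X + 0 := by
        refine polynomial_ext_zmod (d := 5) (natDegree_lineRestrict_le hf _ _) ?_ (by omega)
          fun t => ?_
        · rw [← Polynomial.C_0]
          exact Polynomial.natDegree_cubic_le.trans (by omega)
        · rw [eval_lineRestrict, hexp]
          simp only [Polynomial.eval_add, Polynomial.eval_mul, Polynomial.eval_C,
            Polynomial.eval_pow, Polynomial.eval_X, Polynomial.eval_zero]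
          ring
      have hroot := hs b a (-eval b (polar 2 f a) / eval b (polar 3 f a)) (by
        rw [eval_lineRestrict, hexp]
        field_simp
        ring)
      rw [hline] at hroot
      simp only [zero_mul, add_zero, Polynomial.derivative_add, Polynomial.derivative_C_mul,
        Polynomial.derivative_X_pow, Polynomial.eval_add, Polynomial.eval_mul, Polynomial.eval_C,
        Polynomial.eval_pow, Polynomial.eval_X, Nat.cast_ofNat, Nat.reduceSub, pow_one] at hroot
      field_simp at hroot
      have h2 : eval b (polar 2 f a) ^ 2 = 0 := by linear_combination hroot
      exact hc (pow_eq_zero_iff two_ne_zero |>.mp h2)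
    have := hexp 1
    rw [hboth.1, hboth.2, one_smul, add_comm b] at this
    rw [this]
    ring
  let Z : Submodule (ZMod p) (Fin N → ZMod p) :=
    { carrier := {x | eval x f = 0}
      add_mem' := fun ha hb => hadd ha hb
      zero_mem' := hf.eval_zero_eq (by omega)
      smul_mem' := fun t x (hx : eval x f = 0) => by
        change eval (t • x) f = 0
        rw [hf.eval_smul_eq, hx, mul_zero] }
  have hZ := hno' Z fun x hx => hx
  obtain ⟨W, hW⟩ := Submodule.exists_isCompl Z
  have hdim := Submodule.finrank_add_eq_of_isCompl hW
  rw [finrank_fin_fun] at hdim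
  obtain ⟨x, hxW, hx0, hx⟩ := exists_ne_zero_mem_common_zero (fun _ : Unit => f) (fun _ => 5)
    (fun _ => hf) (fun _ => by omega) W (by simp; omega)
  exact hx0 (Submodule.disjoint_def.mp hW.disjoint x (hx ()) hxW)

end ZeroSubspace

section LinearSubstitution

open MvPolynomial

variable {R S : Type*} [CommRing R] [CommRing S] {N : ℕ}

/-- The polynomial `P (T y)` in the variables `y`. -/
noncomputable def linearSubst (T : Matrix (Fin N) (Fin N) R) (P : MvPolynomial (Fin N) R) :
    MvPolynomial (Fin N) R :=
  aeval (fun i => ∑ j, C (T i j) * X j) P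

theorem linearSubst_isHomogeneous (T : Matrix (Fin N) (Fin N) R) {P : MvPolynomial (Fin N) R}
    {d : ℕ} (hP : P.IsHomogeneous d) : (linearSubst T P).IsHomogeneous d := by
  simpa [linearSubst] using hP.aeval (n := 1) (fun i => ∑ j, C (T i j) * X j)
    (fun i => IsHomogeneous.sum _ _ _ fun j _ => (isHomogeneous_X R j).C_mul _)

theorem eval_map_linearSubst (φ : R →+* S) (T : Matrix (Fin N) (Fin N) R)
    (P : MvPolynomial (Fin N) R) (y : Fin N → S) :
    eval y (map φ (linearSubst T P)) = eval ((T.map φ).mulVec y) (map φ P) := by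
  have h : ((eval y).comp (map φ)).comp (aeval (R := R) fun i : Fin N =>
      (∑ j, C (T i j) * X j : MvPolynomial (Fin N) R)).toRingHom =
      (eval ((T.map φ).mulVec y)).comp (map φ) := by
    refine ringHom_ext (fun r => ?_) (fun i => ?_)
    · simp
    · simp [Matrix.mulVec, dotProduct]
  exact RingHom.congr_fun h P

theorem map_lineRestrict (φ : R →+* S) (P : MvPolynomial (Fin N) R) (v a : Fin N → R) :
    (lineRestrict P v a).map φ = lineRestrict (map φ P) (φ ∘ v) (φ ∘ a) := by
  have h : (Polynomial.mapRingHom φ).comp (aeval (R := R) fun i : Fin N =>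
      Polynomial.C (v i) + Polynomial.C (a i) * Polynomial.X).toRingHom =
      (aeval (R := S) fun i : Fin N => Polynomial.C ((φ ∘ v) i) +
        Polynomial.C ((φ ∘ a) i) * Polynomial.X).toRingHom.comp (map φ) := by
    refine ringHom_ext (fun r => ?_) (fun i => ?_)
    · simp
    · simp
  exact RingHom.congr_fun h P

end LinearSubstitution

section PadicForms

open MvPolynomial Module

variable {p : ℕ} [Fact p.Prime] {N : ℕ}

theorem PadicInt.toZMod_eq_zero_iff (x : ℤ_[p]) : PadicInt.toZMod x = 0 ↔ (p : ℤ_[p]) ∣ x := by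
  rw [← RingHom.mem_ker, PadicInt.ker_toZMod, PadicInt.maximalIdeal_eq_span_p,
    Ideal.mem_span_singleton]

theorem PadicInt.exists_toZMod_comp_eq {ι : Type*} (v : ι → ZMod p) :
    ∃ V : ι → ℤ_[p], PadicInt.toZMod ∘ V = v :=
  ⟨_, funext fun i => Function.surjInv_eq (ZMod.ringHom_surjective PadicInt.toZMod) (v i)⟩

/-- By Hensel's lemma, the reduction of an anisotropic form has only singular zeros. -/
theorem isSingularForm_map_toZMod {G : MvPolynomial (Fin N) ℤ_[p]} (hG : G.IsHomogeneous 5)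
    (hG0 : ∀ y, eval y G = 0 → y = 0) : IsSingularForm (map PadicInt.toZMod G) := by
  intro v a t ht
  by_contra hder
  obtain ⟨V, rfl⟩ := PadicInt.exists_toZMod_comp_eq v
  obtain ⟨A, rfl⟩ := PadicInt.exists_toZMod_comp_eq a
  obtain ⟨T, rfl⟩ := ZMod.ringHom_surjective (PadicInt.toZMod (p := p)) t
  rw [← map_lineRestrict, Polynomial.eval_map_apply, PadicInt.toZMod_eq_zero_iff,
    ← PadicInt.norm_lt_one_iff_dvd] at ht
  rw [← map_lineRestrict, Polynomial.derivative_map, Polynomial.eval_map_apply,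
    PadicInt.toZMod_eq_zero_iff, ← PadicInt.norm_lt_one_iff_dvd] at hder
  have h1 : ‖(lineRestrict G V A).derivative.eval T‖ = 1 :=
    le_antisymm (PadicInt.norm_le_one _) (not_lt.mp hder)
  obtain ⟨z, hz, -, hz', -⟩ := hensels_lemma (p := p) (R := ℤ_[p]) (F := lineRestrict G V A)
    (a := T) (by simpa [Polynomial.coe_aeval_eq_eval, h1] using ht)
  simp only [Polynomial.coe_aeval_eq_eval, eval_lineRestrict, h1] at hz hz'
  have hVA := hG0 _ hz
  have hline : lineRestrict G V A =
      (Polynomial.X - Polynomial.C z) ^ 5 * Polynomial.C (eval A G) := by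
    refine Polynomial.funext fun s => ?_
    have hvec : V + s • A = (s - z) • A := by
      rw [sub_smul, ← sub_eq_zero, ← hVA]
      abel
    rw [eval_lineRestrict, hvec, hG.eval_smul_eq]
    simp
  rw [hline] at hz'
  simp [Polynomial.derivative_pow] at hz'

theorem exists_pow_mul_eq_map (f : MvPolynomial (Fin N) ℚ_[p]) :
    ∃ (k : ℕ) (G : MvPolynomial (Fin N) ℤ_[p]), C ((p : ℚ_[p]) ^ k) * f =
      map PadicInt.Coe.ringHom G := by
  induction f using MvPolynomial.induction_on with
  | C a =>
    obtain ⟨k, hk⟩ := pow_unbounded_of_one_lt ‖a‖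
      (show (1 : ℝ) < p by exact_mod_cast (Fact.out : p.Prime).one_lt)
    have hpk : (0 : ℝ) < (p : ℝ) ^ k := (norm_nonneg a).trans_lt hk
    obtain ⟨z, hz⟩ : ∃ z : ℤ_[p], (z : ℚ_[p]) = p ^ k * a := by
      refine ⟨⟨p ^ k * a, ?_⟩, rfl⟩
      rw [norm_mul, norm_pow, Padic.norm_p, inv_pow, inv_mul_le_one₀ hpk]
      exact hk.le
    exact ⟨k, C z, by rw [map_C, ← C_mul, ← hz]; rfl⟩
  | add f g hf hg =>
    obtain ⟨k, G, hG⟩ := hf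
    obtain ⟨l, H, hH⟩ := hg
    refine ⟨k + l, C ((p : ℤ_[p]) ^ l) * G + C ((p : ℤ_[p]) ^ k) * H, ?_⟩
    rw [map_add, map_mul, map_mul, ← hG, ← hH, pow_add]
    simp only [map_pow, map_natCast, map_mul]
    ring
  | mul_X f i hf =>
    obtain ⟨k, G, hG⟩ := hf
    exact ⟨k, G * X i, by rw [map_mul, ← hG, map_X, mul_assoc]⟩

theorem exists_pos_mul_norm_pow_le {f : MvPolynomial (Fin N) ℚ_[p]} {d : ℕ}
    (hf : f.IsHomogeneous d) (hd : d ≠ 0) (h0 : ∀ x, eval x f = 0 → x = 0) :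
    ∃ c : ℝ, 0 < c ∧ ∀ x, c * ‖x‖ ^ d ≤ ‖eval x f‖ := by
  rcases isEmpty_or_nonempty (Fin N) with hN | hN
  · exact ⟨1, one_pos, fun x => by
      rw [Subsingleton.elim x 0, norm_zero, zero_pow hd, mul_zero]
      exact norm_nonneg _⟩
  obtain ⟨x₀, hx₀, hmin⟩ := (isCompact_sphere (0 : Fin N → ℚ_[p]) 1).exists_isMinOn
    ⟨fun _ => 1, by simp⟩ ((MvPolynomial.continuous_eval f).norm.continuousOn)
  refine ⟨‖eval x₀ f‖, norm_pos_iff.mpr fun h => ?_, fun x => ?_⟩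
  · simp [h0 x₀ h] at hx₀
  · obtain ⟨i, -, hi⟩ := Finset.exists_mem_eq_sup' (s := (Finset.univ : Finset (Fin N)))
      Finset.univ_nonempty (fun i => ‖x i‖₊)
    have hxi : ‖x‖ = ‖x i‖ := by
      rw [Pi.norm_def, ← Finset.sup'_eq_sup Finset.univ_nonempty, hi]
      rfl
    by_cases hx : x = 0
    · rw [hx, norm_zero, zero_pow hd, mul_zero]
      exact norm_nonneg _
    have hxi0 : x i ≠ 0 := by
      rw [← norm_ne_zero_iff, ← hxi]
      exact norm_ne_zero_iff.mpr hx
    have hmem : (x i)⁻¹ • x ∈ Metric.sphere (0 : Fin N → ℚ_[p]) 1 := by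
      rw [mem_sphere_zero_iff_norm, norm_smul, norm_inv, hxi,
        inv_mul_cancel₀ (norm_ne_zero_iff.mpr hxi0)]
    have hle : ‖eval x₀ f‖ ≤ ‖eval ((x i)⁻¹ • x) f‖ := hmin hmem
    have hfx := hf.eval_smul_eq (x i) ((x i)⁻¹ • x)
    rw [smul_inv_smul₀ hxi0] at hfx
    rw [hfx, norm_mul, norm_pow, ← hxi, mul_comm]
    gcongr

theorem norm_det_le_prod (A : Matrix (Fin N) (Fin N) ℚ_[p]) :
    ‖A.det‖ ≤ ∏ j, ‖A.col j‖ := by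
  rw [Matrix.det_apply]
  refine IsUltrametricDist.norm_sum_le_of_forall_le_of_nonneg
    (Finset.prod_nonneg fun j _ => norm_nonneg _) fun σ _ => ?_
  have hsign : ‖Equiv.Perm.sign σ • ∏ i, A (σ i) i‖ = ‖∏ i, A (σ i) i‖ := by
    rcases Int.units_eq_one_or (Equiv.Perm.sign σ) with h | h <;> simp [h]
  rw [hsign, norm_prod]
  exact Finset.prod_le_prod (fun _ _ => norm_nonneg _) fun j _ => norm_le_pi_norm (A.col j) (σ j)

/-- A sublattice of `ℤ_pᴺ` whose reduction lies in a given subspace, of the least index. -/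
theorem exists_matrix_mulVec_mem (W : Submodule (ZMod p) (Fin N → ZMod p)) :
    ∃ (s : ℕ) (T : Matrix (Fin N) (Fin N) ℤ_[p]), finrank (ZMod p) W + s = N ∧
      ‖T.det‖ = (p : ℝ) ^ (-(s : ℤ)) ∧ ∀ y, PadicInt.toZMod ∘ T.mulVec y ∈ W := by
  obtain ⟨W', hW⟩ := Submodule.exists_isCompl W
  have hdim := Submodule.finrank_add_eq_of_isCompl hW
  rw [finrank_fin_fun] at hdim
  let e : Fin (finrank (ZMod p) W) ⊕ Fin (finrank (ZMod p) W') ≃ Fin N :=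
    finSumFinEquiv.trans (finCongr hdim)
  let b : Basis (Fin N) (ZMod p) (Fin N → ZMod p) :=
    (((finBasis (ZMod p) W).prod (finBasis (ZMod p) W')).map
      (Submodule.prodEquivOfIsCompl W W' hW)).reindex e
  have hb (j) : b (e (Sum.inl j)) ∈ W := by
    simp [b]
  obtain ⟨B, hB⟩ := PadicInt.exists_toZMod_comp_eq (fun ij : Fin N × Fin N => b ij.2 ij.1)
  let M : Matrix (Fin N) (Fin N) ℤ_[p] := Matrix.of fun i j => B (i, j)
  have hM (i j) : PadicInt.toZMod (M i j) = b j i := congrFun hB (i, j)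
  have hMb : M.map PadicInt.toZMod = (Pi.basisFun (ZMod p) (Fin N)).toMatrix b := by
    ext i j
    simp [hM, Basis.toMatrix_apply]
  have hdetM : ‖M.det‖ = 1 := by
    refine le_antisymm (PadicInt.norm_le_one _) (not_lt.mp fun h => ?_)
    rw [PadicInt.norm_lt_one_iff_dvd, ← PadicInt.toZMod_eq_zero_iff, RingHom.map_det] at h
    have hu := (Pi.basisFun (ZMod p) (Fin N)).isUnit_det b
    rw [Basis.det_apply, ← hMb] at hu
    exact hu.ne_zero h
  let d : Fin N → ℤ_[p] := fun j => Sum.elim (fun _ => 1) (fun _ => (p : ℤ_[p])) (e.symm j)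
  refine ⟨finrank (ZMod p) W', M * Matrix.diagonal d, hdim, ?_, fun y => ?_⟩
  · rw [Matrix.det_mul, Matrix.det_diagonal, norm_mul, hdetM, one_mul,
      ← e.prod_comp d]
    simp [d]
  · have hsum : PadicInt.toZMod ∘ (M * Matrix.diagonal d).mulVec y =
        ∑ j, PadicInt.toZMod (d j * y j) • b j := by
      ext i
      rw [Function.comp_apply, ← Matrix.mulVec_mulVec, Matrix.mulVec, dotProduct, map_sum,
        Finset.sum_apply]
      refine Finset.sum_congr rfl fun j _ => ?_
      rw [Matrix.mulVec_diagonal, map_mul, hM, Pi.smul_apply, smul_eq_mul, mul_comm]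
    rw [hsum, ← e.sum_comp]
    refine W.sum_mem fun j _ => ?_
    rcases j with j | j
    · exact W.smul_mem _ (hb j)
    · simp [d]

end PadicForms

section Reduction

open MvPolynomial Module

variable {p : ℕ} [Fact p.Prime] {N : ℕ}

/-- After the change of variables `A`, whose determinant has valuation `v`, the form `f` is `p ^ ν`
times a form with coefficients in `ℤ_p`. -/
def IsIntegralModel (f : MvPolynomial (Fin N) ℚ_[p]) (A : Matrix (Fin N) (Fin N) ℚ_[p]) (ν v : ℤ)
    (G : MvPolynomial (Fin N) ℤ_[p]) : Prop :=
  ‖A.det‖ = (p : ℝ) ^ (-v) ∧ G.IsHomogeneous 5 ∧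
    ∀ y, eval (A.mulVec y) f = (p : ℚ_[p]) ^ ν * eval y (map PadicInt.Coe.ringHom G)

variable {f : MvPolynomial (Fin N) ℚ_[p]}

theorem exists_isIntegralModel (hf : f.IsHomogeneous 5) :
    ∃ A ν v G, IsIntegralModel f A ν v G := by
  obtain ⟨k, G, hG⟩ := exists_pow_mul_eq_map f
  have hp0 : (p : ℚ_[p]) ≠ 0 := Nat.cast_ne_zero.mpr (Fact.out : p.Prime).ne_zero
  refine ⟨1, -(k : ℤ), 0, G, by simp, ?_, fun y => ?_⟩
  · exact IsHomogeneous.of_map (f := PadicInt.Coe.ringHom) Subtype.coe_injective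
      (hG ▸ hf.C_mul _)
  · rw [Matrix.one_mulVec, ← hG, map_mul, eval_C, zpow_neg, zpow_natCast,
      inv_mul_cancel_left₀ (pow_ne_zero k hp0)]

theorem IsIntegralModel.exists_bound (hf : f.IsHomogeneous 5) (h0 : ∀ x, eval x f = 0 → x = 0) :
    ∃ b : ℤ, ∀ A ν v G, IsIntegralModel f A ν v G → N * ν - 5 * v ≤ b := by
  obtain ⟨c, hc, hle⟩ := exists_pos_mul_norm_pow_le hf (by omega) h0
  have hp1 : (1 : ℝ) < p := by exact_mod_cast (Fact.out : p.Prime).one_lt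
  have hp0 : (0 : ℝ) < p := by linarith
  obtain ⟨b, hb⟩ := pow_unbounded_of_one_lt ((c ^ N)⁻¹) hp1
  refine ⟨b, fun A ν v G ⟨hdet, hG, heval⟩ => ?_⟩
  have hcol (j : Fin N) : c * ‖A.col j‖ ^ 5 ≤ (p : ℝ) ^ (-ν) := by
    refine (hle _).trans ?_
    rw [← Matrix.mulVec_single_one, heval, norm_mul, Padic.norm_p_zpow]
    refine mul_le_of_le_one_right (by positivity) ?_
    have hsingle : (Pi.single j 1 : Fin N → ℚ_[p]) =
        PadicInt.Coe.ringHom ∘ (Pi.single j 1 : Fin N → ℤ_[p]) := by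
      ext i
      rw [Function.comp_apply, Pi.single_apply, Pi.single_apply]
      split_ifs <;> simp
    rw [hsingle, ← MvPolynomial.map_eval]
    exact PadicInt.norm_le_one _
  have hprod : c ^ N * ‖A.det‖ ^ 5 ≤ ((p : ℝ) ^ (-ν)) ^ N := by
    calc c ^ N * ‖A.det‖ ^ 5 ≤ c ^ N * (∏ j, ‖A.col j‖) ^ 5 := by
          gcongr
          exact norm_det_le_prod A
      _ = ∏ j, c * ‖A.col j‖ ^ 5 := by
          rw [Finset.prod_mul_distrib, Finset.prod_pow, Finset.prod_const, Finset.card_univ,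
            Fintype.card_fin]
      _ ≤ ∏ _j : Fin N, (p : ℝ) ^ (-ν) :=
          Finset.prod_le_prod (fun j _ => by positivity) fun j _ => hcol j
      _ = ((p : ℝ) ^ (-ν)) ^ N := by
          rw [Finset.prod_const, Finset.card_univ, Fintype.card_fin]
  rw [hdet, ← zpow_natCast ((p : ℝ) ^ (-v)), ← zpow_natCast ((p : ℝ) ^ (-ν)), ← zpow_mul,
    ← zpow_mul] at hprod
  have hlt : (p : ℝ) ^ (N * ν - 5 * v) < (p : ℝ) ^ (b : ℤ) := by
    refine lt_of_le_of_lt ?_ (hb.trans_eq (zpow_natCast _ _).symm)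
    rw [show (N * ν - 5 * v : ℤ) = -v * (5 : ℕ) - -ν * N by push_cast; ring, zpow_sub₀ hp0.ne',
      div_le_iff₀ (by positivity), le_inv_mul_iff₀ (by positivity)]
    exact hprod
  exact ((zpow_lt_zpow_iff_right₀ hp1).mp hlt).le

theorem IsIntegralModel.eq_zero (h0 : ∀ x, eval x f = 0 → x = 0)
    {A : Matrix (Fin N) (Fin N) ℚ_[p]} {ν v : ℤ} {G : MvPolynomial (Fin N) ℤ_[p]}
    (h : IsIntegralModel f A ν v G) {y : Fin N → ℤ_[p]} (hy : eval y G = 0) : y = 0 := by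
  have hp0 : (p : ℝ) ≠ 0 := Nat.cast_ne_zero.mpr (Fact.out : p.Prime).ne_zero
  have hdet : A.det ≠ 0 := by
    rw [← norm_ne_zero_iff, h.1]
    exact zpow_ne_zero _ hp0
  have hAy : A.mulVec (PadicInt.Coe.ringHom ∘ y) = 0 := by
    refine h0 _ ?_
    rw [h.2.2, ← MvPolynomial.map_eval, hy, map_zero, mul_zero]
  have := Matrix.eq_zero_of_mulVec_eq_zero hdet hAy
  ext i
  exact Subtype.coe_injective (congrFun this i)

theorem IsIntegralModel.exists_improvement (hp : 37 ≤ p) (h0 : ∀ x, eval x f = 0 → x = 0)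
    {A : Matrix (Fin N) (Fin N) ℚ_[p]} {ν v : ℤ} {G : MvPolynomial (Fin N) ℤ_[p]}
    (h : IsIntegralModel f A ν v G) :
    ∃ (s : ℕ) (A' : Matrix (Fin N) (Fin N) ℚ_[p]) (G' : MvPolynomial (Fin N) ℤ_[p]),
      s ≤ 5 ∧ IsIntegralModel f A' (ν + 1) (v + s) G' := by
  have hpp : (p : ℚ_[p]) ≠ 0 := Nat.cast_ne_zero.mpr (Fact.out : p.Prime).ne_zero
  have hpr : (p : ℝ) ≠ 0 := Nat.cast_ne_zero.mpr (Fact.out : p.Prime).ne_zero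
  obtain ⟨hdet, hG, heval⟩ := id h
  obtain ⟨W, hW, hWf⟩ := (isSingularForm_map_toZMod hG fun y hy => h.eq_zero h0 hy).exists_submodule
    hp (hG.map _)
  obtain ⟨s, T, hs, hT, hTW⟩ := exists_matrix_mulVec_mem W
  have hred : map PadicInt.toZMod (linearSubst T G) = 0 := by
    refine ((linearSubst_isHomogeneous T hG).map _).eq_zero_of_forall_eval_eq_zero_of_le_card
      (fun y => ?_) ?_
    · obtain ⟨Y, rfl⟩ := PadicInt.exists_toZMod_comp_eq y
      rw [eval_map_linearSubst, show (T.map PadicInt.toZMod).mulVec (PadicInt.toZMod ∘ Y) =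
        PadicInt.toZMod ∘ T.mulVec Y from funext fun i => (RingHom.map_mulVec _ T Y i).symm]
      exact hWf _ (hTW Y)
    · rw [Cardinal.mk_fintype, ZMod.card]
      exact_mod_cast (by omega : 5 ≤ p)
  obtain ⟨G', hG'⟩ : C (p : ℤ_[p]) ∣ linearSubst T G := by
    rw [C_dvd_iff_dvd_coeff]
    intro m
    rw [← PadicInt.toZMod_eq_zero_iff, ← coeff_map, hred, coeff_zero]
  refine ⟨s, A * T.map PadicInt.Coe.ringHom, G', by omega, ?_, fun m hm => ?_, fun y => ?_⟩
  · rw [Matrix.det_mul, norm_mul, hdet, ← RingHom.mapMatrix_apply, ← RingHom.map_det,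
      neg_add, zpow_add₀ hpr, ← hT]
    rfl
  · refine (linearSubst_isHomogeneous T hG) (show coeff m (linearSubst T G) ≠ 0 from ?_)
    rw [hG', coeff_C_mul]
    exact mul_ne_zero (Nat.cast_ne_zero.mpr (Fact.out : p.Prime).ne_zero) hm
  · rw [← Matrix.mulVec_mulVec, heval, ← eval_map_linearSubst, hG', map_mul, map_mul, map_C, eval_C,
      map_natCast, zpow_add_one₀ hpp, mul_assoc]

end Reduction

/-- **Leep–Yeomans**. For any prime `p ≥ 47`, every homogeneous polynomial of degree `5`
in `n+1` variables over `ℚ_p`, with `n ≥ 25`, has a nontrivial zero. -/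
theorem leep_yeomans_quintic (p : ℕ) [Fact p.Prime] (hp : 47 ≤ p)
    (n : ℕ) (hn : 25 ≤ n)
    (f : MvPolynomial (Fin (n + 1)) ℚ_[p]) (hf : f.IsHomogeneous 5) :
    ∃ x : Fin (n + 1) → ℚ_[p], x ≠ 0 ∧ MvPolynomial.eval x f = 0 := by
  by_contra! hno
  have h0 (x : Fin (n + 1) → ℚ_[p]) (hx : MvPolynomial.eval x f = 0) : x = 0 := by
    by_contra hx0
    exact hno x hx0 hx
  obtain ⟨b, hb⟩ := IsIntegralModel.exists_bound hf h0
  obtain ⟨A₀, ν₀, v₀, G₀, hmodel⟩ := exists_isIntegralModel hf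
  obtain ⟨m, ⟨A, ν, v, G, h, rfl⟩, hmax⟩ := Int.exists_greatest_of_bdd
    (P := fun m => ∃ A ν v G, IsIntegralModel f A ν v G ∧ m = (n + 1 : ℕ) * ν - 5 * v)
    ⟨b, by rintro _ ⟨A, ν, v, G, h, rfl⟩; exact hb A ν v G h⟩ ⟨_, A₀, ν₀, v₀, G₀, hmodel, rfl⟩
  obtain ⟨s, A', G', hs, h'⟩ := h.exists_improvement (by omega) h0
  have := hmax _ ⟨A', ν + 1, v + s, G', h', rfl⟩
  push_cast at this
  linarith
end

section
/- Let k be a C_i field, let r ≥ 1 and d ≥ 1 be natural numbers, and let f_1, …, f_r be homogeneous polynomials, all of the same degree d, in n+1 variables with coefficients in k, where n ≥ r·d^i. Then the system f_1 = … = f_r = 0 has a nontrivial common solution: there exists x ∈ k^{n+1} with x ≠ 0 and f_j(x) = 0 for all j. -/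
/-- A field `K` is `C_i` if every homogeneous polynomial of degree `m ≥ 1` in `n+1`
variables with `m ^ i ≤ n` has a nontrivial zero over `K`. -/
def IsCField (i : ℕ) (K : Type*) [Field K] : Prop :=
  ∀ (n m : ℕ), 1 ≤ m → m ^ i ≤ n →
    ∀ f : MvPolynomial (Fin (n + 1)) K, f.IsHomogeneous m →
      ∃ x : Fin (n + 1) → K, x ≠ 0 ∧ MvPolynomial.eval x f = 0

open MvPolynomial

theorem MvPolynomial.eval_aeval_eq_eval {σ τ R : Type*} [CommSemiring R]
    (g : σ → MvPolynomial τ R) (x : τ → R) (φ : MvPolynomial σ R) :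
    eval x (aeval g φ) = eval (fun i => eval x (g i)) φ := by
  induction φ using MvPolynomial.induction_on <;> simp_all

/-- There is a form of degree `D` in `N` variables over `k` without nontrivial zeros. -/
def HasAnisotropicForm (k : Type*) [Field k] (N D : ℕ) : Prop :=
  ∃ φ : MvPolynomial (Fin N) k, φ.IsHomogeneous D ∧ ∀ x : Fin N → k, eval x φ = 0 → x = 0

/-- Setting variables to zero preserves anisotropy. -/
theorem HasAnisotropicForm.mono {k : Type*} [Field k] {N N' D : ℕ}
    (h : HasAnisotropicForm k N D) (hN : N' ≤ N) : HasAnisotropicForm k N' D := by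
  obtain ⟨φ, hφ, hφ0⟩ := h
  refine ⟨aeval (fun j : Fin N => if h : (j : ℕ) < N' then X ⟨j, h⟩ else 0) φ, ?_, ?_⟩
  · rw [← one_mul D]
    refine hφ.aeval _ fun j => ?_
    split_ifs
    · exact isHomogeneous_X _ _
    · exact isHomogeneous_zero _ _ _
  · intro x hx
    rw [eval_aeval_eq_eval] at hx
    ext j
    simpa using congrFun (hφ0 _ hx) (Fin.castLE hN j)

/-- Substituting `M` copies, in disjoint sets of variables, of a system of `r` forms without
nontrivial common zeros into an anisotropic form in `M * r` variables. -/
theorem HasAnisotropicForm.comp {k : Type*} [Field k] {M N r d D : ℕ}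
    (h : HasAnisotropicForm k (M * r) D) (f : Fin r → MvPolynomial (Fin N) k)
    (hf : ∀ j, (f j).IsHomogeneous d) (hf0 : ∀ x : Fin N → k, (∀ j, eval x (f j) = 0) → x = 0) :
    HasAnisotropicForm k (M * N) (d * D) := by
  obtain ⟨φ, hφ, hφ0⟩ := h
  refine ⟨aeval (fun p : Fin (M * r) => rename
    (fun j => finProdFinEquiv ((finProdFinEquiv.symm p).1, j)) (f (finProdFinEquiv.symm p).2)) φ,
    hφ.aeval _ fun p => (hf _).rename_isHomogeneous, ?_⟩
  intro x hx
  rw [eval_aeval_eq_eval] at hx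
  have key := hφ0 _ hx
  ext q
  obtain ⟨⟨a, b⟩, rfl⟩ := finProdFinEquiv.surjective q
  refine congrFun (hf0 (fun j => x (finProdFinEquiv (a, j))) fun j => ?_) b
  have := congrFun key (finProdFinEquiv (a, j))
  simpa [eval_rename, Function.comp_def] using this

/-- The norm form of a finite extension is anisotropic. -/
theorem hasAnisotropicForm_finrank (k K : Type*) [Field k] [Field K] [Algebra k K]
    [FiniteDimensional k K] :
    HasAnisotropicForm k (Module.finrank k K) (Module.finrank k K) := by
  let b := Module.finBasis k K
  let A : Matrix (Fin (Module.finrank k K)) (Fin (Module.finrank k K))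
      (MvPolynomial (Fin (Module.finrank k K)) k) :=
    Matrix.of fun s t => ∑ i, C (Algebra.leftMulMatrix b (b i) s t) * X i
  refine ⟨A.det, ?_, ?_⟩
  · rw [Matrix.det_apply]
    refine IsHomogeneous.sum _ _ _ fun σ _ => ?_
    rw [Units.smul_def, zsmul_eq_mul, ← map_intCast (C (R := k))]
    refine IsHomogeneous.C_mul ?_ _
    have hA : ∀ s t, (A s t).IsHomogeneous 1 := fun s t =>
      IsHomogeneous.sum Finset.univ (fun i => C (Algebra.leftMulMatrix b (b i) s t) * X i) 1
        fun i _ => isHomogeneous_C_mul_X _ _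
    simpa using IsHomogeneous.prod Finset.univ (fun s => A (σ s) s) (fun _ => 1) fun s _ => hA _ _
  · intro x hx
    have hA : (eval x).mapMatrix A = Algebra.leftMulMatrix b (∑ i, x i • b i) := by
      ext s t
      simp [A, Matrix.sum_apply, mul_comm]
    rw [RingHom.map_det, hA, ← Algebra.norm_eq_matrix_det, Algebra.norm_eq_zero_iff] at hx
    ext i
    exact Fintype.linearIndependent_iff.mp b.linearIndependent x hx i

/-- Over a field that is not algebraically closed there are anisotropic forms of arbitrarily large
degree in as many variables. -/
theorem exists_hasAnisotropicForm_of_not_isAlgClosed {k : Type*} [Field k] (hk : ¬ IsAlgClosed k)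
    (B : ℕ) : ∃ e, B ≤ e ∧ HasAnisotropicForm k e e := by
  obtain ⟨p, hp, hirr, hroot⟩ : ∃ p : Polynomial k, p.Monic ∧ Irreducible p ∧
      ∀ x, p.eval x ≠ 0 := by
    by_contra! h
    exact hk (IsAlgClosed.of_exists_root k h)
  have := Fact.mk hirr
  have hfin : FiniteDimensional k (AdjoinRoot p) := hp.finite_adjoinRoot
  set e := Module.finrank k (AdjoinRoot p) with he
  have he2 : 2 ≤ e := by
    have hdeg : e = p.natDegree := by
      rw [he, (AdjoinRoot.powerBasis hirr.ne_zero).finrank, AdjoinRoot.powerBasis_dim]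
    have h0 := hirr.natDegree_pos
    have h1 : p.natDegree ≠ 1 := fun h1 => by
      obtain ⟨x, hx⟩ := Polynomial.exists_root_of_degree_eq_one
        ((Polynomial.degree_eq_iff_natDegree_eq_of_pos one_pos).2 h1)
      exact hroot x hx
    omega
  have hpow : ∀ s : ℕ, HasAnisotropicForm k (e ^ (s + 1)) (e ^ (s + 1)) := by
    have hnorm : HasAnisotropicForm k e e := hasAnisotropicForm_finrank k (AdjoinRoot p)
    intro s
    induction s with
    | zero => simpa using hnorm
    | succ s ih =>
      obtain ⟨φ, hφ, hφ0⟩ := hnorm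
      have h := HasAnisotropicForm.comp (r := 1) (D := e ^ (s + 1)) (by simpa using ih)
        (fun _ => φ) (fun _ => hφ) fun x hx => hφ0 x (hx 0)
      rwa [mul_comm e, ← pow_succ] at h
  exact ⟨e ^ (B + 1), (B.lt_succ_self.trans (Nat.lt_pow_self he2)).le, hpow B⟩

theorem HasAnisotropicForm.le_pow {i : ℕ} {k : Type*} [Field k] (hk : IsCField i k) {N D : ℕ}
    (hD : 1 ≤ D) (h : HasAnisotropicForm k N D) : N ≤ D ^ i := by
  by_contra! hlt
  obtain ⟨n, rfl⟩ : ∃ n, N = n + 1 := ⟨N - 1, by omega⟩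
  obtain ⟨φ, hφ, hφ0⟩ := h
  obtain ⟨x, hx0, hx⟩ := hk n D hD (by omega) φ hφ
  exact hx0 (hφ0 x hx)

/-- Over an algebraically closed field, at most `n` forms of positive degree in `n + 1` variables
have a nontrivial common zero. -/
theorem exists_common_zero_of_isAlgClosed {k : Type*} [Field k] [IsAlgClosed k] {r d n : ℕ}
    (hd : d ≠ 0) (hn : r ≤ n) (f : Fin r → MvPolynomial (Fin (n + 1)) k)
    (hf : ∀ j, (f j).IsHomogeneous d) :
    ∃ x : Fin (n + 1) → k, x ≠ 0 ∧ ∀ j, eval x (f j) = 0 := by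
  by_contra! hcon
  have hzero : ∀ x : Fin (n + 1) → k, (∀ j, eval x (f j) = 0) ↔ x = 0 := by
    refine fun x => ⟨fun hx => ?_, ?_⟩
    · by_contra hx0
      obtain ⟨j, hj⟩ := hcon x hx0
      exact hj (hx j)
    · rintro rfl j
      rw [eval_zero, constantCoeff_eq]
      exact (hf j).coeff_eq_zero (by simpa using hd.symm)
  have hheight : ∀ P : Ideal (MvPolynomial (Fin (n + 1)) k), P.IsMaximal → P.height ≤ r := by
    intro P hP
    obtain ⟨x, rfl⟩ := isMaximal_iff_eq_vanishingIdeal_singleton.1 hP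
    let g : Fin r → MvPolynomial (Fin (n + 1)) k := fun j => aeval (fun i => X i - C (x i)) (f j)
    have hg : ∀ (y : Fin (n + 1) → k) j, eval y (g j) = eval (y - x) (f j) := fun y j => by
      rw [eval_aeval_eq_eval]
      simp [Pi.sub_def]
    have hloc : zeroLocus k (Ideal.span (Set.range g)) = {x} := by
      rw [zeroLocus_span]
      ext y
      simp only [Set.mem_ofPred_eq, Set.forall_mem_range, aeval_eq_eval, hg, hzero,
        Set.mem_singleton_iff, sub_eq_zero]
    have hrad : vanishingIdeal k {x} = (Ideal.span (Set.range g)).radical := by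
      rw [← hloc, vanishingIdeal_zeroLocus_eq_radical]
    have hmin : vanishingIdeal k {x} ∈ (Ideal.span (Set.range g)).minimalPrimes :=
      ⟨⟨hP.isPrime, hrad ▸ Ideal.le_radical⟩, fun Q hQ _ =>
        hrad ▸ hQ.1.radical_le_iff.2 hQ.2⟩
    refine (Ideal.height_le_card_of_mem_minimalPrimes_span (Set.finite_range g) hmin).trans ?_
    have hcard : (Set.range g).ncard ≤ r := by
      rw [← Set.image_univ]
      simpa [Set.ncard_univ] using Set.ncard_image_le (f := g) Set.finite_univ
    exact_mod_cast hcard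
  have hdim : ringKrullDim (MvPolynomial (Fin (n + 1)) k) = (n + 1 : ℕ) := by
    simp [MvPolynomial.ringKrullDim_of_isNoetherianRing]
  have hle : ringKrullDim (MvPolynomial (Fin (n + 1)) k) ≤ (r : ℕ) :=
    (ringKrullDim_le_iff_isMaximal_height_le _).2 fun P hP => by exact_mod_cast hheight P hP
  rw [hdim] at hle
  have : n + 1 ≤ r := by exact_mod_cast hle
  omega

/-- Iterated substitution of a system of `r` forms of degree `d` in more than `r * c` variables
makes the number of variables grow faster than `c ^ m`. -/
theorem HasAnisotropicForm.iterate {k : Type*} [Field k] {N r c d e : ℕ} (hr : 1 ≤ r) (hc : 1 ≤ c)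
    (hN : r * c + 1 ≤ N) (f : Fin r → MvPolynomial (Fin N) k) (hf : ∀ j, (f j).IsHomogeneous d)
    (hf0 : ∀ x : Fin N → k, (∀ j, eval x (f j) = 0) → x = 0)
    (he : HasAnisotropicForm k (r * r) e) (m : ℕ) :
    ∃ M, r ≤ M ∧ (2 * r * c + 1) ^ m ≤ (2 * r) ^ m * M ∧
      HasAnisotropicForm k (M * r) (d ^ m * e) := by
  induction m with
  | zero => exact ⟨r, le_rfl, by simpa using hr, by simpa using he⟩
  | succ m ih =>
    obtain ⟨M, hrM, hM, hA⟩ := ih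
    have hdiv : 1 ≤ M / r := (Nat.one_le_div_iff hr).2 hrM
    have hmod : M < r * (M / r) + r := by
      have := Nat.div_add_mod M r
      have := Nat.mod_lt M hr
      omega
    have hgrow : (2 * r * c + 1) * M ≤ 2 * r * (c * M + M / r) := by nlinarith
    refine ⟨c * M + M / r, by nlinarith, ?_, ?_⟩
    · calc (2 * r * c + 1) ^ (m + 1) = (2 * r * c + 1) * (2 * r * c + 1) ^ m := by ring
        _ ≤ (2 * r * c + 1) * ((2 * r) ^ m * M) := by gcongr
        _ = (2 * r) ^ m * ((2 * r * c + 1) * M) := by ring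
        _ ≤ (2 * r) ^ m * (2 * r * (c * M + M / r)) := by gcongr
        _ = (2 * r) ^ (m + 1) * (c * M + M / r) := by ring
    · rw [pow_succ', mul_assoc]
      refine (hA.comp f hf hf0).mono ?_
      have := Nat.div_mul_le_self M r
      nlinarith

/-- **Artin–Lang–Nagata**. Over a `C_i` field `k`, a system of `r ≥ 1` homogeneous
polynomials of the same degree `d ≥ 1` in `n+1` variables with `n ≥ r·dⁱ` has a
nontrivial common zero. -/
theorem artin_lang_nagata_equal_degrees
    (i : ℕ) (k : Type*) [Field k] (hk : IsCField i k)
    (r d n : ℕ) (hr : 1 ≤ r) (hd : 1 ≤ d) (hn : r * d ^ i ≤ n)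
    (f : Fin r → MvPolynomial (Fin (n + 1)) k)
    (hf : ∀ j, (f j).IsHomogeneous d) :
    ∃ x : Fin (n + 1) → k, x ≠ 0 ∧ ∀ j, MvPolynomial.eval x (f j) = 0 := by
  have hc : 1 ≤ d ^ i := Nat.one_le_pow _ _ hd
  by_cases hac : IsAlgClosed k
  · exact exists_common_zero_of_isAlgClosed (by omega)
      ((Nat.le_mul_of_pos_right r hc).trans hn) f hf
  by_contra! hcon
  have hf0 : ∀ x : Fin (n + 1) → k, (∀ j, eval x (f j) = 0) → x = 0 := by
    intro x hx
    by_contra hx0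
    obtain ⟨j, hj⟩ := hcon x hx0
    exact hj (hx j)
  obtain ⟨e, hle, he⟩ := exists_hasAnisotropicForm_of_not_isAlgClosed hac (r * r)
  have he1 : 1 ≤ e := (Nat.mul_pos hr hr).trans_le hle
  have hbound : ∀ m : ℕ, (2 * r * d ^ i + 1) ^ m ≤ (2 * r * d ^ i) ^ m * e ^ i := by
    intro m
    obtain ⟨M, -, hM, hA⟩ := HasAnisotropicForm.iterate hr hc (by omega) f hf hf0 (he.mono hle) m
    have hMr := hA.le_pow hk (Nat.mul_pos (Nat.pow_pos hd) he1)
    calc (2 * r * d ^ i + 1) ^ m ≤ (2 * r) ^ m * M := hM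
      _ ≤ (2 * r) ^ m * (d ^ m * e) ^ i := by
        gcongr
        exact (Nat.le_mul_of_pos_right M hr).trans hMr
      _ = (2 * r * d ^ i) ^ m * e ^ i := by
        rw [mul_pow (d ^ m), mul_pow (2 * r), pow_right_comm, mul_assoc]
  have hq : 0 < 2 * r * d ^ i := by positivity
  generalize 2 * r * d ^ i = q at hbound hq
  have hq' : (0 : ℝ) < q := by exact_mod_cast hq
  obtain ⟨m, hm⟩ := pow_unbounded_of_one_lt ((e : ℝ) ^ i) (y := ((q : ℝ) + 1) / q)
    ((one_lt_div hq').2 (lt_add_one _))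
  rw [div_pow, lt_div_iff₀ (pow_pos hq' m)] at hm
  have hb : ((q : ℝ) + 1) ^ m ≤ (q : ℝ) ^ m * (e : ℝ) ^ i := by exact_mod_cast hbound m
  linarith
end

section
/- Let k be a C_i field and suppose that k possesses a normic form of level i of every degree: for every natural number d > 1 there exists a homogeneous polynomial of degree d in d^i variables with coefficients in k whose only zero in k^{d^i} is 0. Then for any r ≥ 1 and any homogeneous polynomials f_1, …, f_r in n+1 variables over k, of degrees d_1, …, d_r with each d_j ≥ 1 and n ≥ d_1^i + … + d_r^i, the system f_1 = … = f_r = 0 has a nontrivial common solution: there exists x ∈ k^{n+1} with x ≠ 0 and f_j(x) = 0 for all j. -/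
open MvPolynomial in
/-- Over a field, the kernel of the substitution killing the variables in `s` has height at
least `#s`. -/
lemma card_le_height_ker_aeval {σ k : Type*} [DecidableEq σ] [Field k] (s : Finset σ) :
    (s.card : ℕ∞) ≤ (RingHom.ker (aeval (R := k)
      (fun i : σ => if i ∈ s then 0 else (X i : MvPolynomial σ k)))).height := by
  induction s using Finset.induction_on with
  | empty => simp
  | insert a s ha ih =>
    rw [Finset.card_insert_of_notMem ha]
    push_cast
    have hprime (t : Finset σ) : (RingHom.ker (aeval (R := k)
        (fun i : σ => if i ∈ t then 0 else (X i : MvPolynomial σ k)))).IsPrime :=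
      RingHom.ker_isPrime _
    have := hprime s
    have := hprime (insert a s)
    refine (add_le_add_left ih 1).trans (Ideal.height_add_one_le_of_lt_of_isPrime ?_)
    have hcomp (p : MvPolynomial σ k) :
        aeval (fun i : σ => if i ∈ insert a s then 0 else (X i : MvPolynomial σ k)) p =
        aeval (fun i : σ => if i ∈ insert a s then 0 else (X i : MvPolynomial σ k))
          (aeval (fun i : σ => if i ∈ s then 0 else (X i : MvPolynomial σ k)) p) := by
      rw [← AlgHom.comp_apply]
      congr 1
      ext1 i
      by_cases h : i ∈ s <;> simp [h]
    refine lt_of_le_of_ne (fun p hp => ?_) fun h => ?_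
    · rw [RingHom.mem_ker] at hp ⊢
      rw [hcomp, hp, map_zero]
    · have : (X a : MvPolynomial σ k) ∈ RingHom.ker (aeval (R := k)
          (fun i : σ => if i ∈ s then 0 else (X i : MvPolynomial σ k))) := by
        rw [h]
        simp [RingHom.mem_ker]
      simp [RingHom.mem_ker, ha] at this

open MvPolynomial in
/-- The ideal of the origin in affine `#σ`-space has height at least `#σ`. -/
lemma card_le_height_vanishingIdeal_zero {σ k : Type*} [Fintype σ] [Field k] :
    (Fintype.card σ : ℕ∞) ≤ (vanishingIdeal k {(0 : σ → k)}).height := by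
  classical
  refine (card_le_height_ker_aeval (k := k) (Finset.univ : Finset σ)).trans
    (Ideal.height_mono fun p hp => ?_)
  rw [mem_vanishingIdeal_singleton_iff]
  have h := congrArg (aeval (0 : σ → k)) (RingHom.mem_ker.1 hp)
  rw [← AlgHom.comp_apply, comp_aeval] at h
  simpa [Pi.zero_def] using h

open MvPolynomial in
/-- Fewer forms of positive degree than variables have a nontrivial common zero over an
algebraically closed field. -/
lemma IsAlgClosed.exists_ne_zero_forall_eval_eq_zero {σ ι k : Type*} [Fintype σ] [Fintype ι]
    [Field k] [IsAlgClosed k] (h : Fintype.card ι < Fintype.card σ)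
    (d : ι → ℕ) (hd : ∀ j, 1 ≤ d j) (f : ι → MvPolynomial σ k)
    (hf : ∀ j, (f j).IsHomogeneous (d j)) :
    ∃ x : σ → k, x ≠ 0 ∧ ∀ j, eval x (f j) = 0 := by
  classical
  by_contra! hx
  have hloc : zeroLocus k (Ideal.span (Set.range f)) = {(0 : σ → k)} := by
    ext x
    rw [zeroLocus_span]
    simp only [Set.forall_mem_range, Set.mem_ofPred_eq, Set.mem_singleton_iff, aeval_eq_eval]
    constructor
    · intro h0
      by_contra hne
      obtain ⟨j, hj⟩ := hx x hne
      exact hj (h0 j)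
    · rintro rfl j
      rw [eval_zero, constantCoeff_eq]
      by_contra h0
      have := hf j h0
      rw [map_zero] at this
      exact absurd (hd j) (by omega)
  have hrad : (Ideal.span (Set.range f)).radical = vanishingIdeal k {(0 : σ → k)} := by
    rw [← hloc, vanishingIdeal_zeroLocus_eq_radical]
  have hmin : vanishingIdeal k {(0 : σ → k)} ∈ (Ideal.span (Set.range f)).minimalPrimes := by
    rw [← Ideal.radical_minimalPrimes, hrad, Ideal.minimalPrimes_eq_subsingleton_self]
    rfl
  have hle := card_le_height_vanishingIdeal_zero.trans
    (Ideal.height_le_card_of_mem_minimalPrimes_span_finset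
      (s := Finset.univ.image f) (by simpa using hmin))
  have := (Nat.cast_le.1 hle).trans Finset.card_image_le
  rw [Finset.card_univ] at this
  omega

/-- A `C_0` field is algebraically closed. -/
lemma IsCField.isAlgClosed {k : Type*} [Field k] (hk : IsCField 0 k) : IsAlgClosed k := by
  refine IsAlgClosed.of_exists_root _ fun p hp hirr => ?_
  obtain ⟨x, hx, h0⟩ := hk 1 p.natDegree hirr.natDegree_pos (by simp)
    (p.homogenize p.natDegree) p.isHomogeneous_homogenize
  have hx1 : x 1 ≠ 0 := by
    intro hx1
    apply hx
    rw [Polynomial.homogenize, map_sum, Finset.sum_eq_single (p.natDegree, 0)] at h0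
    · have hx0 : x 0 = 0 := by
        simpa [MvPolynomial.eval_monomial, hp.coeff_natDegree, hirr.natDegree_pos.ne'] using h0
      ext t
      fin_cases t <;> assumption
    · rintro ⟨a, b⟩ hab hne
      have hb : b ≠ 0 := by
        rintro rfl
        simp_all
      simp [MvPolynomial.eval_monomial, Finsupp.prod_fintype, Fin.prod_univ_two, hx1, hb]
    · simp
  rw [Polynomial.eval_homogenize le_rfl _ hx1] at h0
  exact ⟨_, (mul_eq_zero.1 h0).resolve_right (pow_ne_zero _ hx1)⟩

open MvPolynomial in
/-- The defining property of a `C_i` field, for forms in an arbitrary finite set of variables. -/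
lemma IsCField.exists_ne_zero_eval_eq_zero {i : ℕ} {k : Type*} [Field k] (hk : IsCField i k)
    {σ : Type*} [Fintype σ] {m : ℕ} (hm : 1 ≤ m) (h : m ^ i < Fintype.card σ)
    (f : MvPolynomial σ k) (hf : f.IsHomogeneous m) :
    ∃ x : σ → k, x ≠ 0 ∧ eval x f = 0 := by
  obtain ⟨n, hn⟩ := Nat.exists_eq_add_one_of_ne_zero (Nat.ne_zero_of_lt h)
  let e : σ ≃ Fin (n + 1) := Fintype.equivFinOfCardEq hn
  obtain ⟨x, hx, h0⟩ := hk n m hm (by omega) (rename e f) hf.rename_isHomogeneous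
  refine ⟨x ∘ e, fun h' => hx ?_, by rwa [eval_rename] at h0⟩
  ext t
  simpa using congrFun h' (e.symm t)

/-- `k` admits a normic form of level `i` in each positive degree. -/
def HasNormicForms (i : ℕ) (k : Type*) [Field k] : Prop :=
  ∀ d : ℕ, 1 ≤ d → ∃ g : MvPolynomial (Fin (d ^ i)) k,
    g.IsHomogeneous d ∧ ∀ x : Fin (d ^ i) → k, MvPolynomial.eval x g = 0 → x = 0

open MvPolynomial in
/-- Normic forms of degree `1` always exist. -/
lemma HasNormicForms.of_one_lt {i : ℕ} {k : Type*} [Field k]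
    (h : ∀ d : ℕ, 1 < d → ∃ g : MvPolynomial (Fin (d ^ i)) k,
      g.IsHomogeneous d ∧ ∀ x : Fin (d ^ i) → k, eval x g = 0 → x = 0) :
    HasNormicForms i k := by
  intro d hd
  obtain rfl | hd := hd.eq_or_lt
  · refine ⟨X ⟨0, by simp⟩, isHomogeneous_X _ _, fun x hx => ?_⟩
    have : Subsingleton (Fin (1 ^ i)) := by rw [one_pow]; infer_instance
    ext t
    rw [eval_X] at hx
    rw [Subsingleton.elim t, hx, Pi.zero_apply]
  · exact h d hd

open MvPolynomial in
/-- Over a `C_i` field with `i ≥ 1` and enough normic forms, a system of forms of the same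
degree `D` in more than `Dⁱ` times as many variables has a nontrivial common zero. -/
lemma IsCField.exists_common_zero_of_degree_eq {i : ℕ} (hi : i ≠ 0) {k : Type*} [Field k]
    (hk : IsCField i k) (hN : HasNormicForms i k) {ι σ : Type*} [Fintype ι] [Fintype σ]
    {D : ℕ} (hD : 1 ≤ D) (h : Fintype.card ι * D ^ i < Fintype.card σ)
    (f : ι → MvPolynomial σ k) (hf : ∀ j, (f j).IsHomogeneous D) :
    ∃ x : σ → k, x ≠ 0 ∧ ∀ j, eval x (f j) = 0 := by
  set r := Fintype.card ι
  set v := Fintype.card σ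
  obtain hr0 | hr0 := Nat.eq_zero_or_pos r
  · have : IsEmpty ι := Fintype.card_eq_zero_iff.1 hr0
    have : Nonempty σ := Fintype.card_pos_iff.1 (by omega)
    exact ⟨1, one_ne_zero, isEmptyElim⟩
  -- A normic form of degree `E` has room for `q` copies of the system.
  set E := r * v + 1
  set q := E ^ i / r
  have hEi : r * v < E ^ i := (Nat.lt_succ_self _).trans_le (Nat.le_self_pow hi E)
  have hqr : r * q ≤ E ^ i := Nat.mul_div_le _ _
  have hqr' : E ^ i < r * (q + 1) := Nat.lt_mul_div_succ _ hr0
  have hcount : (D * E) ^ i < q * v := by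
    rw [mul_pow]
    have h1 : r * D ^ i + 1 ≤ v := h
    have hvq : v ≤ q := by
      have := hEi.trans hqr'
      have := lt_of_mul_lt_mul_left this (Nat.zero_le r)
      omega
    have hDi : 0 < D ^ i := by positivity
    nlinarith [Nat.mul_lt_mul_of_pos_left hqr' hDi, Nat.mul_le_mul_right (q + 1) h1]
  obtain ⟨Φ, hΦ, hΦ0⟩ := hN E (by omega)
  have hcard : Fintype.card (Fin q × ι) ≤ Fintype.card (Fin (E ^ i)) := by
    simpa [mul_comm q] using hqr
  obtain ⟨e⟩ := Function.Embedding.nonempty_of_card_le hcard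
  let g : Fin (E ^ i) → MvPolynomial (Fin q × σ) k :=
    Function.extend e (fun a => rename (Prod.mk a.1) (f a.2)) 0
  have hg (t) : (g t).IsHomogeneous D := by
    by_cases ht : ∃ a, e a = t
    · obtain ⟨a, rfl⟩ := ht
      simpa only [g, e.injective.extend_apply] using (hf a.2).rename_isHomogeneous
    · simpa only [g, Function.extend_apply' _ _ _ ht, Pi.zero_apply] using isHomogeneous_zero _ _ _
  obtain ⟨x, hx, hx0⟩ := hk.exists_ne_zero_eval_eq_zero (σ := Fin q × σ)
    (Nat.mul_pos hD (Nat.succ_pos _)) (by simpa using hcount) (bind₁ g Φ) (hΦ.aeval g hg)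
  rw [← aeval_eq_eval, aeval_bind₁] at hx0
  have hz := hΦ0 _ hx0
  obtain ⟨⟨a, s⟩, has⟩ := Function.ne_iff.1 hx
  refine ⟨fun s => x (a, s), fun h => has (congrFun h s), fun j => ?_⟩
  have := congrFun hz (e (a, j))
  simpa [g, e.injective.extend_apply, eval_rename, Function.comp_def] using this

open MvPolynomial in
/-- Over a `C_i` field with `i ≥ 1` and enough normic forms, a system of forms of degrees
`d j ≥ 1` in more than `∑ j, d jⁱ` variables has a nontrivial common zero. -/
lemma IsCField.exists_common_zero {i : ℕ} (hi : i ≠ 0) {k : Type*} [Field k]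
    (hk : IsCField i k) (hN : HasNormicForms i k) {ι σ : Type*} [Fintype ι] [Fintype σ]
    (d : ι → ℕ) (hd : ∀ j, 1 ≤ d j) (h : ∑ j, d j ^ i < Fintype.card σ)
    (f : ι → MvPolynomial σ k) (hf : ∀ j, (f j).IsHomogeneous (d j)) :
    ∃ x : σ → k, x ≠ 0 ∧ ∀ j, eval x (f j) = 0 := by
  -- Normic forms of degree `e j` raise all degrees to `D`, in `Dⁱ` copies of the variables.
  set D := ∏ j, d j
  have hD : 1 ≤ D := Finset.prod_pos (f := d) fun j _ => hd j
  have hdvd (j) : d j ∣ D := Finset.dvd_prod_of_mem d (Finset.mem_univ j)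
  choose e he using hdvd
  have he1 (j) : 1 ≤ e j := Nat.pos_of_mul_pos_left (hD.trans_eq (he j))
  choose Φ hΦ hΦ0 using fun j => hN (e j) (he1 j)
  let E (j : ι) : Fin (d j ^ i) × Fin (e j ^ i) ≃ Fin (D ^ i) :=
    finProdFinEquiv.trans (finCongr (by rw [← mul_pow, ← he j]))
  let g (j : ι) (a : Fin (d j ^ i)) (t : Fin (e j ^ i)) : MvPolynomial (Fin (D ^ i) × σ) k :=
    rename (Prod.mk (E j (a, t))) (f j)
  obtain ⟨x, hx, hx0⟩ := hk.exists_common_zero_of_degree_eq hi hN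
    (ι := Σ j, Fin (d j ^ i)) (σ := Fin (D ^ i) × σ) hD
    (by
      simp only [Fintype.card_sigma, Fintype.card_fin, Fintype.card_prod]
      rw [mul_comm]
      exact Nat.mul_lt_mul_of_pos_left h (by positivity))
    (fun a => bind₁ (g a.1 a.2) (Φ a.1)) (fun a => by
      have := (hΦ a.1).aeval (g a.1 a.2) fun t => (hf a.1).rename_isHomogeneous
      rwa [← he a.1] at this)
  obtain ⟨⟨l, s⟩, hls⟩ := Function.ne_iff.1 hx
  refine ⟨fun s => x (l, s), fun h => hls (congrFun h s), fun j => ?_⟩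
  obtain ⟨⟨a, t⟩, rfl⟩ := (E j).surjective l
  have hz := hx0 ⟨j, a⟩
  rw [← aeval_eq_eval, aeval_bind₁] at hz
  simpa [g, eval_rename, Function.comp_def] using congrFun (hΦ0 j _ hz) t

/-- **Lang**. Let `k` be a `C_i` field possessing, for every degree `d > 1`, a normic form
of level `i` and degree `d` (a homogeneous polynomial of degree `d` in `dⁱ` variables
whose only zero is trivial). Then any system of `r ≥ 1` homogeneous polynomials of
degrees `d 1, …, d r ≥ 1` in `n+1` variables with `n ≥ ∑ (d j)ⁱ` has a nontrivial common
zero. -/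
theorem lang_normic_forms_system
    (i : ℕ) (k : Type*) [Field k] (hk : IsCField i k)
    (hnormic : ∀ d : ℕ, 1 < d → ∃ g : MvPolynomial (Fin (d ^ i)) k,
      g.IsHomogeneous d ∧ ∀ x : Fin (d ^ i) → k, MvPolynomial.eval x g = 0 → x = 0)
    (r n : ℕ) (hr : 1 ≤ r) (d : Fin r → ℕ) (hd : ∀ j, 1 ≤ d j)
    (hn : (∑ j, d j ^ i) ≤ n)
    (f : Fin r → MvPolynomial (Fin (n + 1)) k)
    (hf : ∀ j, (f j).IsHomogeneous (d j)) :
    ∃ x : Fin (n + 1) → k, x ≠ 0 ∧ ∀ j, MvPolynomial.eval x (f j) = 0 := by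
  obtain rfl | hi := eq_or_ne i 0
  · have := hk.isAlgClosed
    exact IsAlgClosed.exists_ne_zero_forall_eval_eq_zero
      (by simpa [Nat.lt_succ_iff] using hn) d hd f hf
  · exact hk.exists_common_zero hi (.of_one_lt hnormic) d hd
      (by simpa [Nat.lt_succ_iff] using hn) f hf
end

section
/- Let k be a C_1 field and let D be a division ring which is a finite-dimensional algebra over k whose center is exactly k. Then D = k, i.e. the dimension of D as a k-vector space equals 1. (Equivalently: the Brauer group of a C_1 field is trivial.) -/
/-- A field `K` is `C_1` if every homogeneous polynomial of degree `m` with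
`1 ≤ m ≤ n` in `n+1` variables has a nontrivial zero over `K`. -/
def IsC1Field (K : Type*) [Field K] : Prop :=
  ∀ (n m : ℕ), 1 ≤ m → m ≤ n →
    ∀ f : MvPolynomial (Fin (n + 1)) K, f.IsHomogeneous m →
      ∃ x : Fin (n + 1) → K, x ≠ 0 ∧ MvPolynomial.eval x f = 0

open scoped TensorProduct

/-- Scalar extension of a central division algebra is a simple ring. -/
theorem isSimpleRing_tensorProduct_of_isCentral (k D K : Type*) [Field k] [DivisionRing D]
    [Algebra k D] [Algebra.IsCentral k D] [Field K] [Algebra k K] : IsSimpleRing (D ⊗[k] K) := by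
  classical
  refine isSimpleRing_iff_isTwoSided_imp.mpr ⟨inferInstance, fun I hI ↦ ?_⟩
  refine or_iff_not_imp_left.mpr fun hne ↦ ?_
  let c := Module.Basis.ofVectorSpace k K
  let b := Algebra.TensorProduct.basis D c
  have repr_left (d : D) (x : D ⊗[k] K) (i) : b.repr ((d ⊗ₜ 1) * x) i = d * b.repr x i := by
    have : (d ⊗ₜ[k] (1 : K)) * x = d • x := by
      induction x with
      | zero => simp
      | tmul y z => simp [TensorProduct.smul_tmul']
      | add y z hy hz => rw [mul_add, hy, hz, smul_add]
    simp [this]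
  have repr_right (d : D) (x : D ⊗[k] K) (i) : b.repr (x * (d ⊗ₜ 1)) i = b.repr x i * d := by
    induction x with
    | zero => simp
    | tmul y z =>
      simp [b, Algebra.TensorProduct.basis_repr_tmul, mul_assoc, Algebra.commutes]
    | add y z hy hz => simp [add_mul, hy, hz]
  obtain ⟨x, ⟨hxI, hx0⟩, hmin⟩ := WellFounded.has_min
    (InvImage.wf (fun x : D ⊗[k] K ↦ (b.repr x).support.card) wellFounded_lt)
    {x | x ∈ I ∧ x ≠ 0} (Submodule.exists_mem_ne_zero_of_ne_bot hne)
  simp only [Set.mem_ofPred_eq, InvImage, not_lt, and_imp] at hmin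
  obtain ⟨i, hi⟩ : ∃ i, b.repr x i ≠ 0 := by
    by_contra! h
    exact hx0 (b.repr.map_eq_zero_iff.mp (Finsupp.ext h))
  -- Normalise one coefficient of an element of minimal support to be `1`.
  set y := ((b.repr x i)⁻¹ ⊗ₜ[k] (1 : K)) * x with hy
  have hyI : y ∈ I := I.mul_mem_left _ hxI
  have hyi : b.repr y i = 1 := by rw [hy, repr_left, inv_mul_cancel₀ hi]
  have hcomm (d : D) : (d ⊗ₜ[k] (1 : K)) * y = y * (d ⊗ₜ 1) := by
    by_contra hd
    have hle := hmin (d ⊗ₜ[k] (1 : K) * y - y * (d ⊗ₜ 1))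
      (I.sub_mem (I.mul_mem_left _ hyI) (I.mul_mem_right _ hyI)) (sub_ne_zero.mpr hd)
    refine absurd hle (not_le.mpr (Finset.card_lt_card ?_))
    refine Finset.ssubset_iff_subset_ne.mpr ⟨fun j hj ↦ ?_, fun h ↦ ?_⟩
    · rw [Finsupp.mem_support_iff] at hj ⊢
      contrapose hj
      simp [repr_left, repr_right, hy, hj]
    · have : i ∈ (b.repr x).support := Finsupp.mem_support_iff.mpr hi
      rw [← h, Finsupp.mem_support_iff] at this
      simp [repr_left, repr_right, hyi] at this
  have hcoef (j) : ∃ a : k, b.repr y j = algebraMap k D a :=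
    (Algebra.IsCentral.mem_center_iff k).mp <| Subalgebra.mem_center_iff.mpr fun d ↦ by
      rw [← repr_left, ← repr_right, hcomm]
  choose a ha using hcoef
  obtain ⟨z, hz⟩ : ∃ z : K, y = 1 ⊗ₜ z := by
    refine ⟨∑ j ∈ (b.repr y).support, a j • c j, ?_⟩
    conv_lhs => rw [← b.linearCombination_repr y, Finsupp.linearCombination_apply, Finsupp.sum]
    rw [TensorProduct.tmul_sum]
    refine Finset.sum_congr rfl fun j _ ↦ ?_
    simp [ha, b, TensorProduct.smul_tmul', Algebra.algebraMap_eq_smul_one]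
  have hz0 : z ≠ 0 := by
    rintro rfl
    simp [hz] at hyi
  rw [Ideal.eq_top_iff_one]
  have := I.mul_mem_left (1 ⊗ₜ z⁻¹) hyI
  rwa [hz, Algebra.TensorProduct.tmul_mul_tmul, inv_mul_cancel₀ hz0, one_mul] at this

/-- Every module over a simple Artinian ring is isotypic of the type of any simple left ideal. -/
theorem IsSimpleRing.isIsotypicOfType (A M : Type*) [Ring A] [IsSimpleRing A] [IsArtinianRing A]
    [AddCommGroup M] [Module A M] (S : Ideal A) [IsSimpleModule A S] : IsIsotypicOfType A M S :=
  fun m _ ↦ by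
    obtain ⟨I, ⟨e⟩⟩ := IsSemisimpleRing.exists_linearEquiv_ideal_of_isSimpleModule A m
    have := IsSimpleModule.congr e.symm
    exact ⟨e.trans (IsSimpleRing.isIsotypic A A S I).some⟩

/-- Modules of the same finite dimension over a finite-dimensional simple algebra
are isomorphic. -/
theorem IsSimpleRing.nonempty_linearEquiv_of_finrank_eq (K A V W : Type*) [Field K] [Ring A]
    [Algebra K A] [IsSimpleRing A] [FiniteDimensional K A]
    [AddCommGroup V] [Module K V] [Module A V] [IsScalarTower K A V] [FiniteDimensional K V]
    [AddCommGroup W] [Module K W] [Module A W] [IsScalarTower K A W] [FiniteDimensional K W]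
    (h : Module.finrank K V = Module.finrank K W) : Nonempty (V ≃ₗ[A] W) := by
  have := IsArtinianRing.of_finite K A
  obtain ⟨S, hS⟩ := IsAtomic.exists_atom (Ideal A)
  have := isSimpleModule_iff_isAtom.mpr hS
  have := IsSimpleModule.nontrivial A S
  have : Module.Finite A V := .of_restrictScalars_finite K A V
  have : Module.Finite A W := .of_restrictScalars_finite K A W
  obtain ⟨n, ⟨e⟩⟩ := (IsSimpleRing.isIsotypicOfType A V S).linearEquiv_fun
  obtain ⟨n', ⟨e'⟩⟩ := (IsSimpleRing.isIsotypicOfType A W S).linearEquiv_fun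
  have : Module.Finite K S := inferInstanceAs (Module.Finite K (S.restrictScalars K))
  have hn : n = n' := by
    rw [(e.restrictScalars K).finrank_eq, (e'.restrictScalars K).finrank_eq,
      Module.finrank_pi_fintype, Module.finrank_pi_fintype] at h
    simpa [Module.finrank_pos.ne'] using h
  subst hn
  exact ⟨e.trans e'.symm⟩

theorem IsSimpleRing.det_eq_det {K A V W : Type*} [Field K] [Ring A]
    [Algebra K A] [IsSimpleRing A] [FiniteDimensional K A]
    [AddCommGroup V] [Module K V] [FiniteDimensional K V]
    [AddCommGroup W] [Module K W] [FiniteDimensional K W]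
    (h : Module.finrank K V = Module.finrank K W)
    (φ : A →ₐ[K] Module.End K V) (ψ : A →ₐ[K] Module.End K W) (a : A) :
    LinearMap.det (φ a) = LinearMap.det (ψ a) := by
  let : Module A V := Module.compHom V φ.toRingHom
  let : Module A W := Module.compHom W ψ.toRingHom
  have hV (a : A) (v : V) : a • v = φ a v := rfl
  have hW (a : A) (w : W) : a • w = ψ a w := rfl
  have : IsScalarTower K A V := ⟨fun c a v ↦ by simp [hV]⟩
  have : IsScalarTower K A W := ⟨fun c a v ↦ by simp [hW]⟩
  obtain ⟨e⟩ := IsSimpleRing.nonempty_linearEquiv_of_finrank_eq K A V W h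
  rw [← LinearMap.det_conj (φ a) (e.restrictScalars K)]
  congr 1
  ext w
  simpa [hV, hW] using e.map_smul a (e.symm w)

theorem mem_range_algebraMap_of_algHom_apply_eq {k L : Type*} (K : Type*) [Field k] [Field L]
    [Field K] [Algebra k L] [Algebra k K] [Algebra.IsSeparable k L] [IsAlgClosed K] (y : L)
    (h : ∀ σ τ : L →ₐ[k] K, σ y = τ y) : y ∈ (algebraMap k L).range := by
  rw [← minpoly.natDegree_eq_one_iff, ← Polynomial.card_rootSet_eq_natDegree (K := K)
    (Algebra.IsSeparable.isSeparable k y) (IsAlgClosed.splits _)]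
  have hr := Algebra.IsAlgebraic.range_eval_eq_rootSet_minpoly (F := k) K y
  have σ : L →ₐ[k] K := IsAlgClosed.lift
  rw [Fintype.card_eq_one_iff]
  refine ⟨⟨σ y, hr ▸ ⟨σ, rfl⟩⟩, ?_⟩
  rintro ⟨z, hz⟩
  rw [← hr] at hz
  obtain ⟨τ, rfl⟩ := hz
  exact Subtype.ext (h τ σ)

/-- The determinant of a matrix representation of a central division algebra over an extension `L`
has the same image under all embeddings of `L`. -/
theorem algHom_det_eq_algHom_det {k E L K n : Type*} [Field k] [DivisionRing E] [Algebra k E]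
    [Algebra.IsCentral k E] [FiniteDimensional k E] [Field L] [Algebra k L] [Field K]
    [Algebra k K] [Fintype n] [DecidableEq n] (ρ : E →ₐ[k] Matrix n n L) (x : E)
    (σ τ : L →ₐ[k] K) : σ (ρ x).det = τ (ρ x).det := by
  have : IsSimpleRing (K ⊗[k] E) := .of_ringEquiv
    (Algebra.TensorProduct.comm k E K).toRingEquiv (isSimpleRing_tensorProduct_of_isCentral k E K)
  let φ (σ : L →ₐ[k] K) : K ⊗[k] E →ₐ[K] Module.End K (n → K) :=
    (Matrix.toLinAlgEquiv' : Matrix n n K ≃ₐ[K] _).toAlgHom.comp <|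
      Algebra.TensorProduct.lift (Algebra.ofId K _) (σ.mapMatrix.comp ρ) fun c _ ↦ by
        rw [Algebra.ofId_apply]
        exact Algebra.commute_algebraMap_left c _
  have key (σ : L →ₐ[k] K) : LinearMap.det (φ σ (1 ⊗ₜ x)) = σ (ρ x).det := by
    have : φ σ (1 ⊗ₜ x) = Matrix.toLin' (σ.mapMatrix (ρ x)) := by
      simp only [φ, AlgHom.comp_apply, Algebra.TensorProduct.lift_tmul, map_one, one_mul]
      rfl
    rw [this, LinearMap.det_toLin', AlgHom.map_det]
  rw [← key, ← key]
  exact IsSimpleRing.det_eq_det rfl _ _ _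

/-- The determinant of a matrix representation of a central division algebra over a separable
extension takes values in the base field. -/
theorem det_mem_range_algebraMap {k E L n : Type*} [Field k] [DivisionRing E] [Algebra k E]
    [Algebra.IsCentral k E] [FiniteDimensional k E] [Field L] [Algebra k L]
    [Algebra.IsSeparable k L] [Fintype n] [DecidableEq n]
    (ρ : E →ₐ[k] Matrix n n L) (x : E) : (ρ x).det ∈ (algebraMap k L).range :=
  mem_range_algebraMap_of_algHom_apply_eq (AlgebraicClosure k) _ (algHom_det_eq_algHom_det ρ x)

/-- A polynomial map over an extension field with values in the base field at base field points
is given there by a polynomial over the base field. -/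
theorem MvPolynomial.IsHomogeneous.exists_eval_eq {k L σ : Type*} [Field k] [Field L] [Algebra k L]
    {m : ℕ} {P : MvPolynomial σ L} (hP : P.IsHomogeneous m)
    (h : ∀ x : σ → k, eval (algebraMap k L ∘ x) P ∈ (algebraMap k L).range) :
    ∃ Q : MvPolynomial σ k, Q.IsHomogeneous m ∧
      ∀ x : σ → k, algebraMap k L (eval x Q) = eval (algebraMap k L ∘ x) P := by
  obtain ⟨l, hl⟩ := (Algebra.linearMap k L).exists_leftInverse_of_injective
    (LinearMap.ker_eq_bot.mpr (algebraMap k L).injective)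
  refine ⟨∑ s ∈ P.support, monomial s (l (P.coeff s)), ?_, fun x ↦ ?_⟩
  · exact IsHomogeneous.sum _ _ _ fun s hs ↦
      isHomogeneous_monomial _ (by
        rw [← hP (mem_support_iff.mp hs), Finsupp.degree_eq_weight_one]; rfl)
  · obtain ⟨c, hc⟩ := h x
    have hlc : l (algebraMap k L c) = c := LinearMap.congr_fun hl c
    rw [← hc]
    congr 1
    rw [← hlc, hc, eval_eq (algebraMap k L ∘ x), map_sum, map_sum]
    refine Finset.sum_congr rfl fun s _ ↦ ?_
    have : P.coeff s * ∏ i ∈ s.support, (algebraMap k L ∘ x) i ^ s i =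
        (∏ i ∈ s.support, x i ^ s i) • P.coeff s := by
      simp [Algebra.smul_def, mul_comm]
    rw [this, map_smul, eval_monomial, Finsupp.prod, smul_eq_mul, mul_comm]

theorem Matrix.det_isHomogeneous {n σ R : Type*} [Fintype n] [DecidableEq n] [CommRing R]
    (M : Matrix n n (MvPolynomial σ R)) (hM : ∀ i j, (M i j).IsHomogeneous 1) :
    M.det.IsHomogeneous (Fintype.card n) := by
  simp only [Matrix.det_apply, Units.smul_def, zsmul_eq_mul]
  refine MvPolynomial.IsHomogeneous.sum _ _ _ fun g _ ↦ ?_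
  rw [← map_intCast (MvPolynomial.C : R →+* MvPolynomial σ R)]
  refine MvPolynomial.IsHomogeneous.C_mul ?_ _
  simpa using MvPolynomial.IsHomogeneous.prod Finset.univ _ (fun _ ↦ 1) fun i _ ↦ hM (g i) i

/-- A central division algebra over a `C_1` field contains no nontrivial separable extension. -/
theorem IsC1Field.finrank_eq_one_of_algHom {k D L : Type*} [Field k] (hk : IsC1Field k)
    [DivisionRing D] [Algebra k D] [FiniteDimensional k D] [Algebra.IsCentral k D]
    [Field L] [Algebra k L] [FiniteDimensional k L] [Algebra.IsSeparable k L] (f : L →ₐ[k] D) :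
    Module.finrank k L = 1 := by
  let : Module L D := Module.compHom D f.toRingHom
  have hsmul (c : L) (d : D) : c • d = f c * d := rfl
  have : IsScalarTower k L D := ⟨fun c a d ↦ by simp [hsmul]⟩
  have : SMulCommClass Dᵐᵒᵖ L D := ⟨fun a c d ↦ by simp [hsmul, mul_assoc]⟩
  have : FiniteDimensional L D := .right k L D
  by_contra hne
  have hL : 0 < Module.finrank k L := Module.finrank_pos
  have hD : 0 < Module.finrank L D := Module.finrank_pos
  have hmul := Module.finrank_mul_finrank k L D
  set m := Module.finrank L D
  obtain ⟨n, hn⟩ : ∃ n, Module.finrank k D = n + 1 :=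
    Nat.exists_eq_succ_of_ne_zero (Module.finrank_pos).ne'
  have hmn : m ≤ n := by
    have : 2 * m ≤ n + 1 := by
      rw [← hn, ← hmul]
      exact Nat.mul_le_mul_right _ (by omega)
    omega
  let β : Module.Basis (Fin m) L D := Module.finBasis L D
  let ρ : Dᵐᵒᵖ →ₐ[k] Matrix (Fin m) (Fin m) L :=
    ((LinearMap.toMatrixAlgEquiv β).toAlgHom.restrictScalars k).comp (Algebra.lsmul k L D)
  let b : Module.Basis (Fin (n + 1)) k Dᵐᵒᵖ :=
    (Module.finBasisOfFinrankEq k D hn).map (MulOpposite.opLinearEquiv k)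
  let P : MvPolynomial (Fin (n + 1)) L :=
    Matrix.det (Matrix.of fun r s ↦ ∑ i, MvPolynomial.C (ρ (b i) r s) * MvPolynomial.X i)
  have hP : P.IsHomogeneous m := by
    have := Matrix.det_isHomogeneous
      (Matrix.of fun r s ↦ ∑ i, MvPolynomial.C (ρ (b i) r s) * MvPolynomial.X i) fun r s ↦ by
        rw [Matrix.of_apply]
        exact MvPolynomial.IsHomogeneous.sum _ _ _ fun i _ ↦
          MvPolynomial.IsHomogeneous.C_mul (MvPolynomial.isHomogeneous_X _ _) _
    rwa [Fintype.card_fin] at this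
  have evalP (x : Fin (n + 1) → k) :
      MvPolynomial.eval (algebraMap k L ∘ x) P = (ρ (∑ i, x i • b i)).det := by
    simp only [P, RingHom.map_det]
    congr 1
    ext r s
    simp only [map_sum, map_smul]
    simp [Matrix.sum_apply, Matrix.smul_apply, Algebra.smul_def (A := L), mul_comm]
  obtain ⟨Q, hQ, evalQ⟩ := hP.exists_eval_eq fun x ↦ by
    rw [evalP]
    exact det_mem_range_algebraMap ρ _
  obtain ⟨x, hx0, hx⟩ := hk n m hD hmn Q hQ
  have hdet := evalQ x
  rw [hx, map_zero, evalP] at hdet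
  have hy : ∑ i, x i • b i ≠ 0 := fun h ↦
    hx0 (funext (Fintype.linearIndependent_iff.mp b.linearIndependent x h))
  have hunit : IsUnit (ρ (∑ i, x i • b i)) := (IsUnit.mk0 _ hy).map ρ
  exact ((Matrix.isUnit_iff_isUnit_det _).mp hunit).ne_zero hdet.symm

theorem AdjoinRoot.algebraIsSeparable {k : Type*} [Field k] {p : Polynomial k}
    [Fact (Irreducible p)] (hp : p.Separable) : Algebra.IsSeparable k (AdjoinRoot p) := by
  have : Module.Finite k (AdjoinRoot p) := (powerBasis (Fact.out : Irreducible p).ne_zero).finite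
  have hroot : IsSeparable k (root p) :=
    hp.of_dvd (minpoly.dvd k (root p) (by simp))
  have := (IntermediateField.isSeparable_adjoin_simple_iff_isSeparable k _).mpr hroot
  have htop : IntermediateField.adjoin k {root p} = ⊤ :=
    (IntermediateField.adjoin_eq_top_iff ..).mpr adjoinRoot_eq_top
  rw [htop] at this
  exact (AlgEquiv.Algebra.isSeparable_iff IntermediateField.topEquiv).mp this

/-- **The Brauer group of a `C_1` field is trivial**: a finite-dimensional division
algebra `D` over a `C_1` field `k` whose center is exactly `k` is equal to `k`, i.e.
`D` has dimension `1` over `k`. -/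
theorem brauer_group_of_C1_field_trivial
    (k : Type*) [Field k] (hk : IsC1Field k)
    (D : Type*) [DivisionRing D] [Algebra k D] [FiniteDimensional k D]
    (hcenter : Subring.center D = (algebraMap k D).range) :
    Module.finrank k D = 1 := by
  have : Algebra.IsCentral k D := ⟨fun x hx ↦ by
    have : x ∈ Subring.center D := hx
    rwa [hcenter] at this⟩
  by_contra hne
  obtain ⟨a, ha, hsep⟩ := JacobsonNoether.exists_separable_and_not_isCentral'
    (mt Subalgebra.bot_eq_top_iff_finrank_eq_one.mp hne)
  have hint : IsIntegral k a := Algebra.IsIntegral.isIntegral a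
  have : Fact (Irreducible (minpoly k a)) := ⟨minpoly.irreducible hint⟩
  have : FiniteDimensional k (AdjoinRoot (minpoly k a)) := (minpoly.monic hint).finite_adjoinRoot
  have := AdjoinRoot.algebraIsSeparable hsep
  let f : AdjoinRoot (minpoly k a) →ₐ[k] D :=
    Ideal.Quotient.liftₐ (Ideal.span {minpoly k a}) (Polynomial.aeval a) fun q hq ↦ by
      obtain ⟨r, rfl⟩ := Ideal.mem_span_singleton.mp hq
      simp
  have hdeg := hk.finrank_eq_one_of_algHom f
  rw [(AdjoinRoot.powerBasis (minpoly.ne_zero hint)).finrank, AdjoinRoot.powerBasis_dim,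
    minpoly.natDegree_eq_one_iff] at hdeg
  exact ha (Algebra.mem_bot.mpr hdeg)
end

section
/- Let k be a C_1 field of characteristic different from 2, and let f be a homogeneous polynomial of degree 4 in the three variables x, y, z with coefficients in k. Then the equation t^2 = f(x, y, z) has a nontrivial solution: there exist x, y, z, t ∈ k, not all zero, with t^2 = f(x, y, z). -/
/-- The form `u² - a v²` is anisotropic when `a` is not a square. -/
theorem eq_zero_of_sq_sub_mul_sq_eq_zero {k : Type*} [Field k] {a u v : k}
    (ha : ¬IsSquare a) (h : u ^ 2 - a * v ^ 2 = 0) : u = 0 ∧ v = 0 := by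
  have hv : v = 0 := by
    by_contra hv
    refine ha ⟨u / v, ?_⟩
    field_simp
    linear_combination -h
  subst hv
  exact ⟨by simpa using h, rfl⟩

/-- Over a `C_1` field of characteristic `≠ 2`, for any quartic form `f(x, y, z)`, the
equation `t² = f(x, y, z)` (defining a del Pezzo surface of degree 2 when `f` is smooth)
has a nontrivial solution. -/
theorem del_pezzo_degree_two_C1
    (k : Type*) [Field k] (hk : IsC1Field k) (h2 : (2 : k) ≠ 0)
    (f : MvPolynomial (Fin 3) k) (hf : f.IsHomogeneous 4) :
    ∃ x y z t : k, ¬(x = 0 ∧ y = 0 ∧ z = 0 ∧ t = 0) ∧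
      t ^ 2 = MvPolynomial.eval ![x, y, z] f := by
  open MvPolynomial in
  by_cases hsq : ∀ a : k, IsSquare a
  · obtain ⟨t, ht⟩ := hsq (eval ![1, 0, 0] f)
    exact ⟨1, 0, 0, t, by simp, by rw [ht, sq]⟩
  · obtain ⟨a, ha⟩ := not_forall.mp hsq
    let ι : Fin 3 → Fin 5 := ![0, 1, 2]
    have hq : (X 3 ^ 2 - C a * X 4 ^ 2 : MvPolynomial (Fin 5) k).IsHomogeneous 2 :=
      (isHomogeneous_X_pow 3 2).sub (by
        simpa using (isHomogeneous_C (Fin 5) a).mul (isHomogeneous_X_pow (R := k) 4 2))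
    obtain ⟨p, hp, hp0⟩ := hk 4 4 (by norm_num) le_rfl
      ((X 3 ^ 2 - C a * X 4 ^ 2) ^ 2 - rename ι f) ((hq.pow 2).sub (hf.rename_isHomogeneous))
    have hι : p ∘ ι = ![p 0, p 1, p 2] := by
      ext i
      fin_cases i <;> rfl
    have heq : (p 3 ^ 2 - a * p 4 ^ 2) ^ 2 = eval ![p 0, p 1, p 2] f := by
      simpa [eval_rename, hι, sub_eq_zero] using hp0
    refine ⟨p 0, p 1, p 2, p 3 ^ 2 - a * p 4 ^ 2, ?_, heq⟩
    rintro ⟨h0, h1, h2, ht⟩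
    obtain ⟨h3, h4⟩ := eq_zero_of_sq_sub_mul_sq_eq_zero ha ht
    apply hp
    ext i
    fin_cases i <;> assumption
end
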